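/- For any λ ≥ 1, c ≥ 0, and k ≥ 0 there exists a constant ε = ε(λ, c, k) such that for any two k-similar (λ, c)-quasi-geodesic paths p and q without backtracking in Γ(G, X ∪ 𝓗) the following hold: (1) the sets of phase vertices of p and q are contained in the closed ε-neighborhoods (with respect to dist_X) of each other; (2) if s is an H_i-component of p with dist_X(s₋, s₊) > ε, then there exists an H_i-component t of q connected to s; (3) if s and t are connected H_i-components of p and q respectively, then dist_X(s₋, t₋) ≤ ε and dist_X(s₊, t₊) ≤ ε. -/

import Mathlib

namespace RelHyp

variable {G : Type*} [Group G] {Λ : Type*}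

/-- Length of a shortest word over the alphabet `S ∪ S⁻¹` representing `g`. -/
noncomputable def wordLength (S : Set G) (g : G) : ℕ :=
  sInf {n | ∃ w : List G, w.length = n ∧ (∀ x ∈ w, x ∈ S ∨ x⁻¹ ∈ S) ∧ w.prod = g}

/-- The free product `F = (∗_λ H_λ) ∗ F(X)`. -/
abbrev RelFree (H : Λ → Subgroup G) (X : Set G) : Type _ :=
  Monoid.Coprod (Monoid.CoprodI fun l => ↥(H l)) (FreeGroup ↥X)

/-- The canonical homomorphism `ε : F → G`. -/
def relEps (H : Λ → Subgroup G) (X : Set G) : RelFree H X →* G :=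
  Monoid.Coprod.lift (Monoid.CoprodI.lift fun l => (H l).subtype)
    (FreeGroup.lift fun x => (x : G))

/-- Letters of the alphabet `X ∪ 𝓗`, where `𝓗 = ⊔_λ (H̃_λ ∖ {1})`. -/
abbrev RelLetter (H : Λ → Subgroup G) (X : Set G) : Type _ :=
  (Σ l : Λ, {h : ↥(H l) // h ≠ 1}) ⊕ (↥X × Bool)

/-- The image of a letter in the free product `F`. -/
def RelLetter.toF {H : Λ → Subgroup G} {X : Set G} : RelLetter H X → RelFree H X
  | Sum.inl ⟨_, h⟩ => Monoid.Coprod.inl (Monoid.CoprodI.of h.1)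
  | Sum.inr (x, b) => Monoid.Coprod.inr (if b then FreeGroup.of x else (FreeGroup.of x)⁻¹)

/-- The element of `G` represented by a letter. -/
def RelLetter.val {H : Λ → Subgroup G} {X : Set G} : RelLetter H X → G
  | Sum.inl ⟨_, h⟩ => (h.1 : G)
  | Sum.inr (x, b) => if b then (x : G) else (x : G)⁻¹

/-- The index `λ` such that the letter belongs to `H̃_λ`, if any. -/
def RelLetter.hIndex {H : Λ → Subgroup G} {X : Set G} : RelLetter H X → Option Λ
  | Sum.inl ⟨l, _⟩ => some l
  | Sum.inr _ => none

/-- The element of `F` represented by a word over `X ∪ 𝓗`. -/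
def wordToF {H : Λ → Subgroup G} {X : Set G} (w : List (RelLetter H X)) : RelFree H X :=
  (w.map RelLetter.toF).prod

/-- `f` is a relative isoperimetric function of the relative presentation `⟨X, H | R⟩`. -/
def IsIsoperFn (H : Λ → Subgroup G) (X : Set G) (R : Set (RelFree H X)) (f : ℕ → ℕ) : Prop :=
  ∀ w : List (RelLetter H X), relEps H X (wordToF w) = 1 →
    ∃ k ≤ f w.length, ∃ r c : Fin k → RelFree H X,
      (∀ i, r i ∈ R) ∧ wordToF w = (List.ofFn fun i => (c i)⁻¹ * r i * c i).prod

/-- `⟨X, H | R⟩` is a finite relative presentation of `G` w.r.t. the collection `H`. -/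
structure IsFiniteRelPres (H : Λ → Subgroup G) (X : Set G) (R : Set (RelFree H X)) : Prop where
  finX : X.Finite
  finR : R.Finite
  surj : Function.Surjective (relEps H X)
  ker : (relEps H X).ker = Subgroup.normalClosure R

/-- `G` is finitely presented relative to the collection of subgroups `H`. -/
def FinitelyPresentedRel (H : Λ → Subgroup G) : Prop :=
  ∃ (X : Set G) (R : Set (RelFree H X)), IsFiniteRelPres H X R

/-- The relative area of a word representing `1`. -/
noncomputable def relArea (H : Λ → Subgroup G) (X : Set G) (R : Set (RelFree H X))
    (w : List (RelLetter H X)) : ℕ :=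
  sInf {k | ∃ r c : Fin k → RelFree H X,
    (∀ i, r i ∈ R) ∧ wordToF w = (List.ofFn fun i => (c i)⁻¹ * r i * c i).prod}

/-- The relative Dehn function of the presentation `⟨X, H | R⟩`. -/
noncomputable def relDehn (H : Λ → Subgroup G) (X : Set G) (R : Set (RelFree H X))
    (n : ℕ) : ℕ :=
  sSup {a | ∃ w : List (RelLetter H X), w.length ≤ n ∧ relEps H X (wordToF w) = 1 ∧
    a = relArea H X R w}

/-- The relative Dehn function is well-defined (finite for each value of the argument),
i.e. there exists a finite-valued relative isoperimetric function. -/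
def DehnWellDefined (H : Λ → Subgroup G) (X : Set G) (R : Set (RelFree H X)) : Prop :=
  ∃ f : ℕ → ℕ, IsIsoperFn H X R f

/-- `f ⪯ g`. -/
def AsympLE (f g : ℕ → ℕ) : Prop := ∃ C K L : ℕ, ∀ n, f n ≤ C * g (K * n) + L * n

/-- `f ∼ g`. -/
def AsympEquiv (f g : ℕ → ℕ) : Prop := AsympLE f g ∧ AsympLE g f

/-- `G` is hyperbolic relative to `H`: it admits a finite relative presentation with a
linear relative isoperimetric function. -/
def IsRelHyperbolic (H : Λ → Subgroup G) : Prop :=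
  ∃ (X : Set G) (R : Set (RelFree H X)), IsFiniteRelPres H X R ∧
    ∃ A B : ℕ, IsIsoperFn H X R fun n => A * n + B

/-- The subnegative closure of `f`. -/
noncomputable def subnegClosure (f : ℕ → ℕ) (n : ℕ) : ℕ :=
  sSup {s | ∃ L : List ℕ, (∀ a ∈ L, 0 < a) ∧ L.sum = n ∧ s = (L.map f).sum}

/-- A combinatorial path in the Cayley graph `Γ(G, X ∪ 𝓗)`: a starting vertex
together with the word labelling the path. -/
structure RelPath (H : Λ → Subgroup G) (X : Set G) where
  start : G
  word : List (RelLetter H X)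

namespace RelPath

variable {H : Λ → Subgroup G} {X : Set G}

/-- The length of the path. -/
def len (p : RelPath H X) : ℕ := p.word.length

/-- The `k`-th vertex of the path. -/
def vertex (p : RelPath H X) (k : ℕ) : G :=
  p.start * ((p.word.take k).map RelLetter.val).prod

/-- The terminal vertex of the path. -/
def finish (p : RelPath H X) : G := p.vertex p.word.length

end RelPath

/-- The combinatorial metric `dist_{X ∪ 𝓗}` on `G`. -/
noncomputable def relDist (H : Λ → Subgroup G) (X : Set G) (g h : G) : ℕ :=
  wordLength (X ∪ ⋃ l, (H l : Set G)) (g⁻¹ * h)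

/-- The relative length `|g|_{X ∪ 𝓗}`. -/
noncomputable def relLen (H : Λ → Subgroup G) (X : Set G) (g : G) : ℕ :=
  wordLength (X ∪ ⋃ l, (H l : Set G)) g

/-- The word metric `dist_X` on `G`. -/
noncomputable def xDist (X : Set G) (g h : G) : ℕ := wordLength X (g⁻¹ * h)

variable {H : Λ → Subgroup G} {X : Set G}

/-- `p` is a `(λ, c)`-quasi-geodesic in `Γ(G, X ∪ 𝓗)`. -/
def IsQuasiGeodesic (lam c : ℝ) (p : RelPath H X) : Prop :=
  ∀ i j : ℕ, i ≤ j → j ≤ p.len →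
    ((j - i : ℕ) : ℝ) ≤ lam * (relDist H X (p.vertex i) (p.vertex j) : ℝ) + c

/-- `p` is a geodesic in `Γ(G, X ∪ 𝓗)`. -/
def IsGeodesic (p : RelPath H X) : Prop :=
  ∀ i j : ℕ, i ≤ j → j ≤ p.len → j - i = relDist H X (p.vertex i) (p.vertex j)

/-- The `k`-th letter of `p` is a letter of `H̃_l`. -/
def LetterIsH (p : RelPath H X) (l : Λ) (k : ℕ) : Prop :=
  ∃ a, p.word[k]? = some a ∧ a.hIndex = some l

/-- The subpath of `p` consisting of the letters with indices `a, …, b` is an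
`H_l`-component of `p` (a maximal nonempty `H_l`-subword). -/
def IsComponent (p : RelPath H X) (l : Λ) (a b : ℕ) : Prop :=
  a ≤ b ∧ b < p.len ∧ (∀ k, a ≤ k → k ≤ b → LetterIsH p l k) ∧
    (a = 0 ∨ ¬ LetterIsH p l (a - 1)) ∧ (b + 1 = p.len ∨ ¬ LetterIsH p l (b + 1))

/-- The `H_l`-components of `p` starting at index `a` and of `q` starting at `a'`
are connected (their vertices lie in the same left coset of `H_l`). -/
def ConnectedComp (p q : RelPath H X) (l : Λ) (a a' : ℕ) : Prop :=
  (p.vertex a)⁻¹ * q.vertex a' ∈ H l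

/-- `p` is a path without backtracking: all of its components are isolated. -/
def NoBacktracking (p : RelPath H X) : Prop :=
  ∀ l a b a' b', IsComponent p l a b → IsComponent p l a' b' →
    ConnectedComp p p l a a' → a = a' ∧ b = b'

/-- The `k`-th vertex of `p` is a phase vertex (not an inner vertex of a component). -/
def IsPhase (p : RelPath H X) (k : ℕ) : Prop :=
  ¬ ∃ l a b, IsComponent p l a b ∧ a < k ∧ k ≤ b

/-- `p` and `q` are `k`-similar: their endpoints are `X`-distance at most `k` apart. -/
def Similar (k : ℝ) (p q : RelPath H X) : Prop :=
  (xDist X p.start q.start : ℝ) ≤ k ∧ (xDist X p.finish q.finish : ℝ) ≤ k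

/-- The Rips thin-triangles condition for `Γ(G, X ∪ 𝓗)` with constant `δ`. -/
def RipsThin (H : Λ → Subgroup G) (X : Set G) (δ : ℝ) : Prop :=
  ∀ p q r : RelPath H X, IsGeodesic p → IsGeodesic q → IsGeodesic r →
    p.finish = q.start → q.finish = r.start → r.finish = p.start →
    ∀ i ≤ p.len, ∃ j : ℕ,
      (j ≤ q.len ∧ (relDist H X (p.vertex i) (q.vertex j) : ℝ) ≤ δ) ∨
      (j ≤ r.len ∧ (relDist H X (p.vertex i) (r.vertex j) : ℝ) ≤ δ)

/-- The Cayley graph `Γ(G, X ∪ 𝓗)` is a hyperbolic metric space. -/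
def CayleyHyperbolic (H : Λ → Subgroup G) (X : Set G) : Prop :=
  ∃ δ : ℝ, 0 ≤ δ ∧ RipsThin H X δ

/-- `R` is a relatively quasi-convex subgroup of `G`. -/
def RelQuasiconvex (H : Λ → Subgroup G) (X : Set G) (R : Subgroup G) : Prop :=
  ∃ σ : ℝ, 0 < σ ∧ ∀ p : RelPath H X, IsGeodesic p → p.start ∈ R → p.finish ∈ R →
    ∀ k ≤ p.len, ∃ w ∈ R, (xDist X (p.vertex k) w : ℝ) ≤ σ

/-- `R` is a strongly relatively quasi-convex subgroup of `G`. -/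
def StronglyRelQuasiconvex (H : Λ → Subgroup G) (X : Set G) (R : Subgroup G) : Prop :=
  RelQuasiconvex H X R ∧ ∀ (g : G) (l : Λ), {x : G | x ∈ R ∧ g * x * g⁻¹ ∈ H l}.Finite

/-- `g` is a hyperbolic element: it is not conjugate to an element of any `H_λ`. -/
def IsHypElt (H : Λ → Subgroup G) (g : G) : Prop :=
  ∀ l : Λ, ∀ x ∈ H l, ¬ IsConj g x

end RelHyp

open RelHyp

namespace RelHyp

section WordLength

variable {G : Type*} [Group G] {S : Set G}

theorem exists_word_of_closure_eq_top (hS : Subgroup.closure S = ⊤) (g : G) :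
    ∃ w : List G, w.length = wordLength S g ∧ (∀ x ∈ w, x ∈ S ∨ x⁻¹ ∈ S) ∧ w.prod = g := by
  have hg : g ∈ (Subgroup.closure S).toSubmonoid := by rw [hS]; trivial
  rw [Subgroup.closure_toSubmonoid] at hg
  obtain ⟨w, hw, hprod⟩ := Submonoid.exists_list_of_mem_closure hg
  exact Nat.sInf_mem (s := {n | ∃ w : List G, w.length = n ∧ (∀ x ∈ w, x ∈ S ∨ x⁻¹ ∈ S) ∧
    w.prod = g}) ⟨w.length, w, rfl, hw, hprod⟩

theorem wordLength_prod_le {w : List G} (hw : ∀ x ∈ w, x ∈ S ∨ x⁻¹ ∈ S) :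
    wordLength S w.prod ≤ w.length :=
  Nat.sInf_le ⟨w, rfl, hw, rfl⟩

theorem wordLength_one : wordLength S (1 : G) = 0 :=
  Nat.le_zero.1 (wordLength_prod_le (w := []) (by simp))

theorem wordLength_le_one {x : G} (hx : x ∈ S ∨ x⁻¹ ∈ S) : wordLength S x ≤ 1 := by
  simpa using wordLength_prod_le (S := S) (w := [x]) (by simpa using hx)

theorem wordLength_mul_le (hS : Subgroup.closure S = ⊤) (g h : G) :
    wordLength S (g * h) ≤ wordLength S g + wordLength S h := by
  obtain ⟨u, hu, hu', rfl⟩ := exists_word_of_closure_eq_top hS g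
  obtain ⟨v, hv, hv', rfl⟩ := exists_word_of_closure_eq_top hS h
  rw [← hu, ← hv, ← List.prod_append, ← List.length_append]
  refine wordLength_prod_le fun x hx => ?_
  rcases List.mem_append.1 hx with h | h
  exacts [hu' x h, hv' x h]

theorem wordLength_inv_le (hS : Subgroup.closure S = ⊤) (g : G) :
    wordLength S g⁻¹ ≤ wordLength S g := by
  obtain ⟨u, hu, hu', rfl⟩ := exists_word_of_closure_eq_top hS g
  rw [← hu, List.prod_inv_reverse]
  refine (wordLength_prod_le fun x hx => ?_).trans (by simp)
  simp only [List.mem_reverse, List.mem_map] at hx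
  obtain ⟨y, hy, rfl⟩ := hx
  simpa using (hu' y hy).symm

theorem wordLength_inv (hS : Subgroup.closure S = ⊤) (g : G) :
    wordLength S g⁻¹ = wordLength S g :=
  (wordLength_inv_le hS g).antisymm (by simpa using wordLength_inv_le hS g⁻¹)

end WordLength

section Metrics

variable {G : Type*} [Group G] {Λ : Type*} {H : Λ → Subgroup G} {X : Set G}

theorem closure_union_eq_top (hX : Subgroup.closure X = ⊤) :
    Subgroup.closure (X ∪ ⋃ l, (H l : Set G)) = ⊤ :=
  top_le_iff.1 (hX ▸ Subgroup.closure_mono Set.subset_union_left)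

theorem xDist_self (x : G) : xDist X x x = 0 := by
  simp [xDist, wordLength_one]

theorem xDist_comm (hX : Subgroup.closure X = ⊤) (x y : G) : xDist X x y = xDist X y x := by
  rw [xDist, xDist, ← wordLength_inv hX]; simp

theorem xDist_triangle (hX : Subgroup.closure X = ⊤) (x y z : G) :
    xDist X x z ≤ xDist X x y + xDist X y z := by
  simpa [xDist, mul_assoc] using wordLength_mul_le hX (x⁻¹ * y) (y⁻¹ * z)

theorem relDist_self (x : G) : relDist H X x x = 0 := by
  simp [relDist, wordLength_one]

theorem relDist_comm (hX : Subgroup.closure X = ⊤) (x y : G) :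
    relDist H X x y = relDist H X y x :=
  xDist_comm (closure_union_eq_top hX) x y

theorem relDist_triangle (hX : Subgroup.closure X = ⊤) (x y z : G) :
    relDist H X x z ≤ relDist H X x y + relDist H X y z :=
  xDist_triangle (closure_union_eq_top hX) x y z

/-- The group element represented by a word over `X ∪ 𝓗`. -/
def wval (w : List (RelLetter H X)) : G := (w.map RelLetter.val).prod

@[simp] theorem wval_nil : wval ([] : List (RelLetter H X)) = 1 := rfl

@[simp] theorem wval_cons (a : RelLetter H X) (w : List (RelLetter H X)) :
    wval (a :: w) = a.val * wval w := by simp [wval]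

@[simp] theorem wval_append (u v : List (RelLetter H X)) :
    wval (u ++ v) = wval u * wval v := by simp [wval]

theorem val_mem_or_inv_mem (a : RelLetter H X) :
    a.val ∈ X ∪ ⋃ l, (H l : Set G) ∨ (a.val)⁻¹ ∈ X ∪ ⋃ l, (H l : Set G) := by
  rcases a with ⟨l, h⟩ | ⟨x, b⟩
  · exact Or.inl (Or.inr (Set.mem_iUnion.2 ⟨l, h.1.2⟩))
  · cases b
    · exact Or.inr (Or.inl (by simp [RelLetter.val]))
    · exact Or.inl (Or.inl (by simp [RelLetter.val]))

theorem relDist_mul_wval_le (x : G) (w : List (RelLetter H X)) :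
    relDist H X x (x * wval w) ≤ w.length := by
  have h := wordLength_prod_le (S := X ∪ ⋃ l, (H l : Set G)) (w := w.map RelLetter.val) (by
    intro y hy
    obtain ⟨a, -, rfl⟩ := List.mem_map.1 hy
    exact val_mem_or_inv_mem a)
  simpa [relDist, wval] using h

theorem relDist_mul_val_le (x : G) (a : RelLetter H X) : relDist H X x (x * a.val) ≤ 1 := by
  simpa using relDist_mul_wval_le x [a]

theorem relDist_le_one_of_mem {x y : G} {l : Λ} (h : x⁻¹ * y ∈ H l) : relDist H X x y ≤ 1 :=
  wordLength_le_one (Or.inl (Or.inr (Set.mem_iUnion.2 ⟨l, h⟩)))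

theorem exists_relWord (hX : Subgroup.closure X = ⊤) (x y : G) :
    ∃ w : List (RelLetter H X), w.length = relDist H X x y ∧ x * wval w = y := by
  obtain ⟨u, hu, hu', hprod⟩ :=
    exists_word_of_closure_eq_top (closure_union_eq_top (H := H) hX) (x⁻¹ * y)
  suffices h : ∀ u : List G, (∀ x ∈ u, x ∈ X ∪ ⋃ l, (H l : Set G) ∨
      x⁻¹ ∈ X ∪ ⋃ l, (H l : Set G)) →
      ∃ w : List (RelLetter H X), w.length ≤ u.length ∧ wval w = u.prod by
    obtain ⟨w, hw, hw'⟩ := h u hu'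
    have hy : x * wval w = y := by rw [hw', hprod]; group
    refine ⟨w, le_antisymm (hw.trans hu.le) ?_, hy⟩
    simpa [hy] using relDist_mul_wval_le x w
  clear hu hu' hprod u
  intro u
  induction u with
  | nil => exact fun _ => ⟨[], by simp⟩
  | cons g u ih =>
    intro h
    obtain ⟨w, hw, hw'⟩ := ih fun x hx => h x (List.mem_cons_of_mem _ hx)
    suffices hg : ∃ v : List (RelLetter H X), v.length ≤ 1 ∧ wval v = g by
      obtain ⟨v, hv, hv'⟩ := hg
      exact ⟨v ++ w, by simp; omega, by simp [hv', hw']⟩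
    have hH : ∀ l, g ∈ H l → ∃ v : List (RelLetter H X), v.length ≤ 1 ∧ wval v = g := by
      intro l hl
      by_cases h1 : g = 1
      · exact ⟨[], by simp [h1]⟩
      · exact ⟨[Sum.inl ⟨l, ⟨⟨g, hl⟩, by simpa [Subtype.ext_iff] using h1⟩⟩], by simp,
          by simp [RelLetter.val]⟩
    rcases h g List.mem_cons_self with (hg | hg) | (hg | hg)
    · exact ⟨[Sum.inr (⟨g, hg⟩, true)], by simp, by simp [RelLetter.val]⟩
    · obtain ⟨l, hl⟩ := Set.mem_iUnion.1 hg
      exact hH l hl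
    · exact ⟨[Sum.inr (⟨g⁻¹, hg⟩, false)], by simp, by simp [RelLetter.val]⟩
    · obtain ⟨l, hl⟩ := Set.mem_iUnion.1 hg
      exact hH l ((H l).inv_mem_iff.1 hl)

theorem exists_xWord (hX : Subgroup.closure X = ⊤) (x y : G) :
    ∃ w : List (RelLetter H X), w.length = xDist X x y ∧ x * wval w = y ∧
      ∀ a ∈ w, a.hIndex = none := by
  obtain ⟨u, hu, hu', hprod⟩ := exists_word_of_closure_eq_top hX (x⁻¹ * y)
  suffices h : ∀ u : List G, (∀ x ∈ u, x ∈ X ∨ x⁻¹ ∈ X) →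
      ∃ w : List (RelLetter H X), w.length = u.length ∧ wval w = u.prod ∧
        ∀ a ∈ w, a.hIndex = none by
    obtain ⟨w, hw, hw', hw''⟩ := h u hu'
    exact ⟨w, hw.trans hu, by rw [hw', hprod]; group, hw''⟩
  clear hu hu' hprod u
  intro u
  induction u with
  | nil => exact fun _ => ⟨[], by simp⟩
  | cons g u ih =>
    intro h
    obtain ⟨w, hw, hw', hw''⟩ := ih fun x hx => h x (List.mem_cons_of_mem _ hx)
    rcases h g List.mem_cons_self with hg | hg
    · exact ⟨Sum.inr (⟨g, hg⟩, true) :: w, by simp [hw], by simp [RelLetter.val, hw'],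
        by simpa [RelLetter.hIndex] using hw''⟩
    · exact ⟨Sum.inr (⟨g⁻¹, hg⟩, false) :: w, by simp [hw], by simp [RelLetter.val, hw'],
        by simpa [RelLetter.hIndex] using hw''⟩

theorem relDist_le_xDist (hX : Subgroup.closure X = ⊤) (x y : G) :
    relDist H X x y ≤ xDist X x y := by
  obtain ⟨w, hw, rfl, -⟩ := exists_xWord (H := H) hX x y
  exact (relDist_mul_wval_le x w).trans hw.le

theorem xDist_mul_val_le_one (x : G) {a : RelLetter H X} (ha : a.hIndex = none) :
    xDist X x (x * a.val) ≤ 1 := by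
  rcases a with ⟨l, h⟩ | ⟨s, b⟩
  · simp [RelLetter.hIndex] at ha
  · simp only [xDist, inv_mul_cancel_left]
    refine wordLength_le_one ?_
    cases b <;> simp [RelLetter.val]

end Metrics

section Cochains

variable {G : Type*} [Group G] {Λ : Type*} {H : Λ → Subgroup G} {X : Set G}

/-- The value on the edge from `x` labelled by a letter of the cochain that is the coboundary of
`P l` on `H l`-edges and is given by `Q` on `X`-edges. -/
def letterWeight (P : Λ → G → ℝ) (Q : ↥X → G → ℝ) (x : G) : RelLetter H X → ℝ
  | Sum.inl ⟨l, h⟩ => P l (x * h.1) - P l x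
  | Sum.inr (s, b) => if b then Q s x else -Q s (x * (s : G)⁻¹)

/-- The value of a cochain on the path that starts at `x` and is labelled by a word. -/
def wsum (P : Λ → G → ℝ) (Q : ↥X → G → ℝ) : G → List (RelLetter H X) → ℝ
  | _, [] => 0
  | x, a :: w => letterWeight P Q x a + wsum P Q (x * a.val) w

variable (P : Λ → G → ℝ) (Q : ↥X → G → ℝ)

@[simp] theorem wsum_nil (x : G) : wsum (H := H) P Q x [] = 0 := rfl

@[simp] theorem wsum_cons (x : G) (a : RelLetter H X) (w : List (RelLetter H X)) :
    wsum P Q x (a :: w) = letterWeight P Q x a + wsum P Q (x * a.val) w := rfl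

theorem wsum_append (x : G) (u v : List (RelLetter H X)) :
    wsum P Q x (u ++ v) = wsum P Q x u + wsum P Q (x * wval u) v := by
  induction u generalizing x with
  | nil => simp
  | cons a u ih => simp [ih, mul_assoc, add_assoc]

/-- The action of `G` on real-valued functions on `G` by right translation. -/
def translationAction (G : Type*) [Group G] : G →* MulAut (Multiplicative (G → ℝ)) where
  toFun g :=
    { toFun := fun D => Multiplicative.ofAdd fun x => D.toAdd (x * g)
      invFun := fun D => Multiplicative.ofAdd fun x => D.toAdd (x * g⁻¹)
      left_inv := fun D => by simp [mul_assoc]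
      right_inv := fun D => by simp [mul_assoc]
      map_mul' := fun D E => rfl }
  map_one' := by ext D : 1; simp
  map_mul' g h := by ext D : 1; simp [mul_assoc]

/-- A cochain as a homomorphism from the free product to a semidirect product. -/
def cochainHom (H : Λ → Subgroup G) :
    RelFree H X →* SemidirectProduct (Multiplicative (G → ℝ)) G (translationAction G) :=
  Monoid.Coprod.lift
    (Monoid.CoprodI.lift fun l =>
      { toFun := fun h => ⟨Multiplicative.ofAdd fun x => P l (x * h) - P l x, h⟩
        map_one' := by ext <;> simp
        map_mul' := fun h h' => by
          refine SemidirectProduct.ext (funext fun x => ?_) (by simp)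
          change P l (x * (h * h' : G)) - P l x =
            (P l (x * h) - P l x) + (P l (x * h * h') - P l (x * h))
          rw [mul_assoc]
          ring })
    (FreeGroup.lift fun s => ⟨Multiplicative.ofAdd (Q s), s⟩)

theorem cochainHom_right (f : RelFree H X) : (cochainHom P Q H f).right = relEps H X f := by
  suffices h : SemidirectProduct.rightHom.comp (cochainHom P Q H) = relEps H X from
    DFunLike.congr_fun h f
  refine Monoid.Coprod.hom_ext ?_ ?_
  · refine Monoid.CoprodI.ext_hom _ _ fun l => ?_
    ext h
    simp [cochainHom, relEps]
  · ext s
    simp [cochainHom, relEps]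

/-- The value of a cochain on an element of the free product, read from a base point. -/
def cochainValue (f : RelFree H X) (x : G) : ℝ := (cochainHom P Q H f).left.toAdd x

theorem cochainValue_one (x : G) : cochainValue P Q (1 : RelFree H X) x = 0 := by
  simp [cochainValue]

theorem cochainValue_mul (f g : RelFree H X) (x : G) :
    cochainValue P Q (f * g) x =
      cochainValue P Q f x + cochainValue P Q g (x * relEps H X f) := by
  rw [← cochainHom_right P Q]
  rw [cochainValue, map_mul, SemidirectProduct.mul_left]
  rfl

theorem cochainValue_toF (a : RelLetter H X) (x : G) :
    cochainValue P Q a.toF x = letterWeight P Q x a := by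
  rcases a with ⟨l, h⟩ | ⟨s, b⟩
  · simp [cochainValue, RelLetter.toF, cochainHom, letterWeight]
  · cases b
    · have h := cochainValue_mul P Q (H := H) (Monoid.Coprod.inr (FreeGroup.of s))⁻¹
        (Monoid.Coprod.inr (FreeGroup.of s)) x
      have h' : ∀ y, cochainValue P Q (H := H) (Monoid.Coprod.inr (FreeGroup.of s)) y = Q s y :=
        fun y => by simp [cochainValue, cochainHom]
      rw [inv_mul_cancel, cochainValue_one, h'] at h
      simp only [RelLetter.toF, letterWeight, Bool.false_eq_true, if_false, map_inv]
      simp only [map_inv, relEps, Monoid.Coprod.lift_apply_inr, FreeGroup.lift_apply_of] at h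
      linarith
    · simp [cochainValue, RelLetter.toF, cochainHom, letterWeight]

theorem relEps_toF (a : RelLetter H X) : relEps H X a.toF = a.val := by
  rcases a with ⟨l, h⟩ | ⟨s, b⟩
  · simp [RelLetter.toF, relEps, RelLetter.val]
  · cases b <;> simp [RelLetter.toF, relEps, RelLetter.val]

theorem wordToF_append (u v : List (RelLetter H X)) :
    wordToF (u ++ v) = wordToF u * wordToF v := by simp [wordToF]

theorem relEps_wordToF (w : List (RelLetter H X)) : relEps H X (wordToF w) = wval w := by
  induction w with
  | nil => simp [wordToF]
  | cons a w ih =>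
    rw [← List.singleton_append, wordToF_append, map_mul, ih]
    simp [wordToF, relEps_toF]

theorem cochainValue_wordToF (w : List (RelLetter H X)) (x : G) :
    cochainValue P Q (wordToF w) x = wsum P Q x w := by
  induction w generalizing x with
  | nil => simp [wordToF, cochainValue_one]
  | cons a w ih =>
    rw [← List.singleton_append, wordToF_append, cochainValue_mul, ih]
    simp [wordToF, relEps_toF, cochainValue_toF]

theorem wordToF_surjective : Function.Surjective (wordToF (H := H) (X := X)) := by
  intro f
  induction f using Monoid.Coprod.induction_on with
  | inl m =>
    induction m using Monoid.CoprodI.induction_on with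
    | one => exact ⟨[], by simp [wordToF]⟩
    | of l h =>
      by_cases h1 : h = 1
      · exact ⟨[], by simp [wordToF, h1]⟩
      · exact ⟨[Sum.inl ⟨l, ⟨h, h1⟩⟩], by simp [wordToF, RelLetter.toF]⟩
    | mul a b ha hb =>
      obtain ⟨u, hu⟩ := ha
      obtain ⟨v, hv⟩ := hb
      exact ⟨u ++ v, by rw [wordToF_append, hu, hv, map_mul]⟩
  | inr n =>
    induction n using FreeGroup.induction_on with
    | C1 => exact ⟨[], by simp [wordToF]⟩
    | of s => exact ⟨[Sum.inr (s, true)], by simp [wordToF, RelLetter.toF]⟩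
    | inv_of s _ => exact ⟨[Sum.inr (s, false)], by simp [wordToF, RelLetter.toF]⟩
    | mul a b ha hb =>
      obtain ⟨u, hu⟩ := ha
      obtain ⟨v, hv⟩ := hb
      exact ⟨u ++ v, by rw [wordToF_append, hu, hv, map_mul]⟩
  | mul a b ha hb =>
    obtain ⟨u, hu⟩ := ha
    obtain ⟨v, hv⟩ := hb
    exact ⟨u ++ v, by rw [wordToF_append, hu, hv]⟩

theorem cochainValue_conj {r : RelFree H X} (hr : relEps H X r = 1) (c : RelFree H X) (x : G) :
    cochainValue P Q (c⁻¹ * r * c) x = cochainValue P Q r (x * (relEps H X c)⁻¹) := by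
  have h := cochainValue_mul P Q c⁻¹ c x
  simp only [inv_mul_cancel, cochainValue_one] at h
  simp only [cochainValue_mul, map_mul, hr, map_inv, mul_one] at h ⊢
  linarith

theorem abs_cochainValue_prod_le {C : ℝ} (L : List (RelFree H X))
    (hL : ∀ f ∈ L, relEps H X f = 1 ∧ ∀ x, |cochainValue P Q f x| ≤ C) (x : G) :
    |cochainValue P Q L.prod x| ≤ L.length * C := by
  induction L with
  | nil => simp [cochainValue_one]
  | cons f L ih =>
    have h1 := hL f List.mem_cons_self
    have h2 := ih fun g hg => hL g (List.mem_cons_of_mem _ hg)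
    rw [List.prod_cons, cochainValue_mul, h1.1, mul_one]
    have := abs_add_le (cochainValue P Q f x) (cochainValue P Q L.prod x)
    have := h1.2 x
    push_cast [List.length_cons]
    linarith

end Cochains

section Filling

variable {G : Type*} [Group G] {Λ : Type*} {H : Λ → Subgroup G} {X : Set G}

theorem wval_flatMap {Y : Set G} {ρ : RelLetter H X → List (RelLetter H Y)}
    (hρ : ∀ a, wval (ρ a) = a.val) (w : List (RelLetter H X)) :
    wval (w.flatMap ρ) = wval w := by
  induction w with
  | nil => simp
  | cons a w ih => simp [ih, hρ]

/-- The linear relative isoperimetric inequality, in a dual form and with respect to an arbitrary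
finite generating set: the value of a cochain on a closed path is bounded linearly in the length of
the path when the cochain is bounded on a fixed finite set of closed words. -/
theorem exists_cochain_bound (hXfin : X.Finite) (hhyp : IsRelHyperbolic H) :
    ∃ (Y : Set G) (U : Set (List (RelLetter H Y))) (ρ : RelLetter H X → List (RelLetter H Y))
      (K : ℝ), U.Finite ∧ Y.Finite ∧ 0 ≤ K ∧ (∀ a, ρ (Sum.inl a) = [Sum.inl a]) ∧
      (∀ s, ρ (Sum.inr s) ∈ U) ∧ (∀ a, wval (ρ a) = a.val) ∧
      ∀ (P : Λ → G → ℝ) (Q : ↥Y → G → ℝ) (C : ℝ), 0 ≤ C →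
        (∀ u ∈ U, wval u = 1 → ∀ y, |wsum P Q y u| ≤ C) →
        ∀ w, wval w = 1 → ∀ x, |wsum P Q x (w.flatMap ρ)| ≤ C * K * (w.length + 1) := by
  obtain ⟨Y, R, hpres, A, B, hiso⟩ := hhyp
  choose ω hω using wordToF_surjective (H := H) (X := Y)
  choose pre hpre using hpres.surj
  have : Finite ↥X := hXfin
  let ρ : RelLetter H X → List (RelLetter H Y) :=
    Sum.elim (fun a => [Sum.inl a]) fun s => ω (pre (RelLetter.val (H := H) (Sum.inr s)))
  let V : Set (List (RelLetter H Y)) := Set.range fun s : ↥X × Bool => ρ (Sum.inr s)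
  have hV : V.Finite := Set.finite_range _
  obtain ⟨M, hM⟩ := (hV.image List.length).bddAbove
  have hρ : ∀ a, wval (ρ a) = a.val := by
    rintro (⟨l, h⟩ | s)
    · simp [ρ, RelLetter.val]
    · simp [ρ, ← relEps_wordToF, hω, hpre]
  have hlen : ∀ w : List (RelLetter H X), (w.flatMap ρ).length ≤ (M + 1) * w.length := by
    intro w
    induction w with
    | nil => simp
    | cons a w ih =>
      have : (ρ a).length ≤ M + 1 := by
        rcases a with a | s
        · simp [ρ]
        · exact (hM ⟨_, ⟨s, rfl⟩, rfl⟩).trans (Nat.le_succ M)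
      simp only [List.flatMap_cons, List.length_append, List.length_cons]
      linarith
  refine ⟨Y, ω '' R ∪ V, ρ, A * (M + 1) + B, (hpres.finR.image _).union hV, hpres.finX,
    by positivity, fun a => rfl, fun s => Or.inr ⟨s, rfl⟩, hρ, ?_⟩
  intro P Q C hC hU w hw x
  obtain ⟨k, hk, r, c, hr, hprod⟩ := hiso (w.flatMap ρ) (by
    rw [relEps_wordToF, wval_flatMap hρ, hw])
  have hr1 : ∀ i, relEps H Y (r i) = 1 := by
    intro i
    have : r i ∈ (relEps H Y).ker := hpres.ker ▸ Subgroup.subset_normalClosure (hr i)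
    exact this
  rw [← cochainValue_wordToF, hprod]
  refine (abs_cochainValue_prod_le P Q (C := C) _ ?_ x).trans ?_
  · intro f hf
    obtain ⟨i, rfl⟩ := List.mem_ofFn.1 hf
    refine ⟨by simp [hr1], fun y => ?_⟩
    rw [cochainValue_conj P Q (hr1 i), ← hω (r i), cochainValue_wordToF]
    refine hU _ (Or.inl ⟨_, hr i, rfl⟩) ?_ _
    rw [← relEps_wordToF, hω, hr1]
  · have h1 : (k : ℝ) ≤ A * ((M + 1) * w.length) + B := by
      have := hk.trans (Nat.add_le_add_right (Nat.mul_le_mul_left A (hlen w)) B)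
      exact_mod_cast this
    have h2 : (k : ℝ) ≤ (A * (M + 1) + B) * (w.length + 1) := by
      have : (0 : ℝ) ≤ A * (M + 1) + B * w.length := by positivity
      linarith
    rw [List.length_ofFn, mul_assoc, mul_comm (k : ℝ)]
    exact mul_le_mul_of_nonneg_left h2 hC

end Filling

section Inequalities

variable {G : Type*} [Group G] {Λ : Type*} {H : Λ → Subgroup G} {X : Set G}

open Classical in
/-- The function that agrees with `φ` on the coset `g H_l`, viewed with index `l`, and vanishes
elsewhere. -/
noncomputable def cosetFn (H : Λ → Subgroup G) (l : Λ) (g : G) (φ : G → ℝ) (l' : Λ) (x : G) : ℝ :=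
  if l' = l ∧ g⁻¹ * x ∈ H l then φ x else 0

theorem abs_cosetFn_sub_le {l : Λ} {g : G} {φ : G → ℝ} {l' : Λ} {x h : G} (hh : h ∈ H l') :
    |cosetFn H l g φ l' (x * h) - cosetFn H l g φ l' x| ≤ |φ (x * h) - φ x| := by
  by_cases h1 : l' = l ∧ g⁻¹ * x ∈ H l
  · have h2 : l' = l ∧ g⁻¹ * (x * h) ∈ H l := by
      refine ⟨h1.1, ?_⟩
      rw [← mul_assoc]
      exact (H l).mul_mem h1.2 (h1.1 ▸ hh)
    simp [cosetFn, if_pos h1, if_pos h2]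
  · have h2 : ¬ (l' = l ∧ g⁻¹ * (x * h) ∈ H l) := by
      rintro ⟨rfl, h2⟩
      refine h1 ⟨rfl, ?_⟩
      rwa [← mul_assoc, (H l').mul_mem_cancel_right hh] at h2
    simp only [cosetFn, if_neg h1, if_neg h2, sub_zero, abs_zero]
    exact abs_nonneg _

theorem exists_component_bound (hXfin : X.Finite) (hhyp : IsRelHyperbolic H) :
    ∃ K : ℝ, 0 ≤ K ∧ ∀ (l : Λ) (g : G) (φ : G → ℝ), (∀ x y, |φ x - φ y| ≤ xDist X x y) →
      ∀ (w : List (RelLetter H X)) (x : G), wval w = 1 →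
        |wsum (cosetFn H l g φ) 0 x w| ≤ K * (w.length + 1) := by
  obtain ⟨Y, U, ρ, K, hU, -, hK, hρH, hρX, hρ, hmain⟩ := exists_cochain_bound hXfin hhyp
  let cost : List (RelLetter H Y) → ℝ := fun u => (u.map fun a => (xDist X 1 a.val : ℝ)).sum
  obtain ⟨M, hM⟩ := (hU.image cost).bddAbove
  refine ⟨|M| * K + |M|, by positivity, fun l g φ hφ w x hw => ?_⟩
  have hletter : ∀ x (a : RelLetter H Y),
      |letterWeight (cosetFn H l g φ) 0 x a| ≤ xDist X 1 a.val := by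
    rintro x (⟨l', h⟩ | ⟨s, b⟩)
    · refine (abs_cosetFn_sub_le h.1.2).trans ?_
      rw [abs_sub_comm]
      refine (hφ _ _).trans (le_of_eq ?_)
      simp [xDist, RelLetter.val]
    · cases b <;> simp [letterWeight]
  have hcost : ∀ (u : List (RelLetter H Y)) x, |wsum (cosetFn H l g φ) 0 x u| ≤ cost u := by
    intro u
    induction u with
    | nil => simp [cost]
    | cons a u ih =>
      intro x
      have := ih (x * a.val)
      have := hletter x a
      have := abs_add_le (letterWeight (cosetFn H l g φ) 0 x a)
        (wsum (cosetFn H l g φ) 0 (x * a.val) u)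
      simp only [wsum_cons, cost, List.map_cons, List.sum_cons] at *
      linarith
  have hUM : ∀ u ∈ U, ∀ x, |wsum (cosetFn H l g φ) 0 x u| ≤ |M| := fun u hu x =>
    (hcost u x).trans ((hM ⟨u, hu, rfl⟩).trans (le_abs_self M))
  have hcmp : ∀ (w : List (RelLetter H X)) x, |wsum (cosetFn H l g φ) 0 x w -
      wsum (cosetFn H l g φ) 0 x (w.flatMap ρ)| ≤ |M| * w.length := by
    intro w
    induction w with
    | nil => simp
    | cons a w ih =>
      intro x
      have h1 := ih (x * a.val)
      have h2 : |letterWeight (cosetFn H l g φ) 0 x a -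
          wsum (cosetFn H l g φ) 0 x (ρ a)| ≤ |M| := by
        rcases a with a | ⟨s, b⟩
        · simp [hρH, letterWeight]
        · have := hUM _ (hρX (s, b)) x
          cases b <;> simpa [letterWeight] using this
      rw [List.flatMap_cons, wsum_append, hρ, wsum_cons, add_sub_add_comm]
      have := abs_add_le (letterWeight (cosetFn H l g φ) 0 x a -
        wsum (cosetFn H l g φ) 0 x (ρ a)) (wsum (cosetFn H l g φ) 0 (x * a.val) w -
        wsum (cosetFn H l g φ) 0 (x * a.val) (w.flatMap ρ))
      push_cast [List.length_cons]
      linarith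
  have h1 := hmain (cosetFn H l g φ) 0 |M| (abs_nonneg _) (fun u hu _ y => hUM u hu y) w hw x
  have h2 := hcmp w x
  have h3 := abs_add_le (wsum (cosetFn H l g φ) 0 x w - wsum (cosetFn H l g φ) 0 x (w.flatMap ρ))
    (wsum (cosetFn H l g φ) 0 x (w.flatMap ρ))
  rw [sub_add_cancel] at h3
  have := abs_nonneg M
  linarith

/-- The Riemann–Stieltjes sum of `g df` along the path that starts at `x` and is labelled by a
word. -/
def stieltjesSum (f g : G → ℝ) : G → List (RelLetter H X) → ℝ
  | _, [] => 0
  | x, a :: w => g x * (f (x * a.val) - f x) + stieltjesSum f g (x * a.val) w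

theorem stieltjesSum_append (f g : G → ℝ) (x : G) (u v : List (RelLetter H X)) :
    stieltjesSum f g x (u ++ v) = stieltjesSum f g x u + stieltjesSum f g (x * wval u) v := by
  induction u generalizing x with
  | nil => simp [stieltjesSum]
  | cons a u ih => simp [stieltjesSum, ih, mul_assoc, add_assoc]

theorem mk_mul_mem {l : Λ} {h : G} (hh : h ∈ H l) (x : G) :
    ((x * h : G) : G ⧸ H l) = (x : G ⧸ H l) := by
  rw [eq_comm, QuotientGroup.eq]; simpa using hh

theorem exists_stieltjesSum_bound (hXfin : X.Finite) (hXgen : Subgroup.closure X = ⊤)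
    (hhyp : IsRelHyperbolic H) :
    ∃ K : ℝ, 0 ≤ K ∧ ∀ f g : G → ℝ, (∀ x y, |f x - f y| ≤ relDist H X x y) →
      (∀ x y, |g x - g y| ≤ relDist H X x y) →
      ∀ (w : List (RelLetter H X)) (x : G), wval w = 1 →
        |stieltjesSum f g x w| ≤ K * (w.length + 1) := by
  obtain ⟨Y, U, ρ, K, hU, hY, hK, hρH, hρX, hρ, hmain⟩ := exists_cochain_bound hXfin hhyp
  obtain ⟨N, hN⟩ := (hU.image List.length).bddAbove
  obtain ⟨M₀, hM₀⟩ := (hY.image fun y => relDist H X 1 y).bddAbove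
  have hNU : ∀ u ∈ U, u.length ≤ N := fun u hu => hN ⟨u, hu, rfl⟩
  set M : ℝ := M₀ + 1 with hMdef
  have hM1 : (1 : ℝ) ≤ M := by simp [hMdef]
  have hstep : ∀ x (a : RelLetter H Y), (relDist H X x (x * a.val) : ℝ) ≤ M := by
    rintro x (⟨l, h⟩ | ⟨s, b⟩)
    · have : relDist H X x (x * (h.1 : G)) ≤ 1 :=
        relDist_le_one_of_mem (l := l) (by simp)
      refine le_trans ?_ hM1
      exact_mod_cast this
    · have h1 : relDist H X 1 (s : G) ≤ M₀ := hM₀ ⟨s, s.2, rfl⟩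
      have h2 : relDist H X x (x * RelLetter.val (H := H) (Sum.inr (s, b))) =
          relDist H X 1 (s : G) := by
        cases b
        · rw [relDist_comm hXgen]; simp [relDist, RelLetter.val]
        · simp [relDist, RelLetter.val]
      rw [h2]
      have : (relDist H X 1 (s : G) : ℝ) ≤ M₀ := by exact_mod_cast h1
      linarith
  have hword : ∀ (u : List (RelLetter H Y)) x, (relDist H X x (x * wval u) : ℝ) ≤ M * u.length := by
    intro u
    induction u with
    | nil => simp [relDist_self]
    | cons a u ih =>
      intro x
      have h1 := ih (x * a.val)
      have h2 := hstep x a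
      have h3 : (relDist H X x (x * wval (a :: u)) : ℝ) ≤ relDist H X x (x * a.val) +
          relDist H X (x * a.val) (x * a.val * wval u) := by
        have := relDist_triangle (H := H) hXgen x (x * a.val) (x * a.val * wval u)
        rw [wval_cons, ← mul_assoc]
        exact_mod_cast this
      push_cast [List.length_cons]
      linarith
  refine ⟨M ^ 2 * (N : ℝ) ^ 2 * K + M ^ 2 * ((N : ℝ) + 1) ^ 2, by positivity,
    fun f g hf hg w x hw => ?_⟩
  let rep : Λ → G → G := fun l x => Quotient.out (x : G ⧸ H l)
  have hrep : ∀ l x, (rep l x)⁻¹ * x ∈ H l := fun l x =>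
    QuotientGroup.eq.1 (Quotient.out_eq (x : G ⧸ H l))
  let P : Λ → G → ℝ := fun l x => g (rep l x) * f x
  let Q : ↥Y → G → ℝ := fun s x => g x * (f (x * s) - f x)
  have hprod : ∀ {a b A B : ℝ}, |a| ≤ A → |b| ≤ B → |a * b| ≤ A * B := by
    intro a b A B ha hb
    rw [abs_mul]
    exact mul_le_mul ha hb (abs_nonneg _) ((abs_nonneg _).trans ha)
  have hletter : ∀ x (a : RelLetter H Y),
      |letterWeight P Q x a - g x * (f (x * a.val) - f x)| ≤ M ^ 2 := by
    rintro x (⟨l, h⟩ | ⟨s, b⟩)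
    · have h1 : rep l (x * h.1) = rep l x := by
        simp only [rep]
        rw [mk_mul_mem h.1.2]
      have h2 : |g (rep l x) - g x| ≤ 1 :=
        (hg _ _).trans (by exact_mod_cast relDist_le_one_of_mem (hrep l x))
      have h3 : |f (x * h.1) - f x| ≤ 1 := by
        rw [abs_sub_comm]
        exact (hf _ _).trans (by exact_mod_cast relDist_le_one_of_mem (l := l) (by simp))
      have h4 := hprod h2 h3
      have h5 : letterWeight P Q x (Sum.inl ⟨l, h⟩ : RelLetter H Y) -
          g x * (f (x * h.1) - f x) = (g (rep l x) - g x) * (f (x * h.1) - f x) := by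
        simp only [letterWeight, P, h1]; ring
      change |letterWeight P Q x (Sum.inl ⟨l, h⟩ : RelLetter H Y) -
          g x * (f (x * h.1) - f x)| ≤ _
      rw [h5]
      nlinarith
    · cases b
      · have h1 := hstep x (Sum.inr (s, false))
        simp only [RelLetter.val, Bool.false_eq_true, if_false] at h1
        have h2 : |g (x * (s : G)⁻¹) - g x| ≤ M := by
          rw [abs_sub_comm]; exact (hg _ _).trans h1
        have h3 : |f (x * (s : G)⁻¹) - f x| ≤ M := by
          rw [abs_sub_comm]; exact (hf _ _).trans h1
        have h4 := hprod h2 h3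
        simp only [letterWeight, Q, RelLetter.val, Bool.false_eq_true, if_false,
          inv_mul_cancel_right]
        convert h4 using 2 <;> ring
      · simp only [letterWeight, Q, RelLetter.val, if_true, sub_self, abs_zero]
        positivity
  have hsum : ∀ (u : List (RelLetter H Y)) x,
      |wsum P Q x u - g x * (f (x * wval u) - f x)| ≤ M ^ 2 * (u.length : ℝ) ^ 2 := by
    intro u
    induction u with
    | nil => simp
    | cons a u ih =>
      intro x
      have h1 := ih (x * a.val)
      have h2 := hletter x a
      have h3 : |g (x * a.val) - g x| ≤ M := by
        rw [abs_sub_comm]; exact (hg _ _).trans (hstep x a)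
      have h4 : |f (x * a.val * wval u) - f (x * a.val)| ≤ M * u.length := by
        rw [abs_sub_comm]; exact (hf _ _).trans (hword u _)
      have h5 := hprod h3 h4
      have h6 : wsum P Q x (a :: u) - g x * (f (x * wval (a :: u)) - f x) =
          (letterWeight P Q x a - g x * (f (x * a.val) - f x)) +
          (wsum P Q (x * a.val) u -
            g (x * a.val) * (f (x * a.val * wval u) - f (x * a.val))) +
          (g (x * a.val) - g x) * (f (x * a.val * wval u) - f (x * a.val)) := by
        rw [wsum_cons, wval_cons, ← mul_assoc]; ring
      rw [h6]
      refine (abs_add_three _ _ _).trans ?_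
      push_cast [List.length_cons]
      have : 0 ≤ M ^ 2 * (u.length : ℝ) := by positivity
      nlinarith
  have hUle : ∀ u ∈ U, M ^ 2 * (u.length : ℝ) ^ 2 ≤ M ^ 2 * (N : ℝ) ^ 2 := by
    intro u hu
    have : (u.length : ℝ) ≤ N := by exact_mod_cast hNU u hu
    gcongr
  have h1 := hmain P Q (M ^ 2 * (N : ℝ) ^ 2) (by positivity) (fun u hu hu1 y => by
    have := hsum u y
    simp only [hu1, mul_one, sub_self, mul_zero, sub_zero] at this
    exact this.trans (hUle u hu)) w hw x
  have hcmp : ∀ (w : List (RelLetter H X)) x, |stieltjesSum f g x w - wsum P Q x (w.flatMap ρ)| ≤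
      M ^ 2 * ((N : ℝ) + 1) ^ 2 * w.length := by
    intro w
    induction w with
    | nil => simp [stieltjesSum]
    | cons a w ih =>
      intro x
      have h1 := ih (x * a.val)
      have h2 : |g x * (f (x * a.val) - f x) - wsum P Q x (ρ a)| ≤ M ^ 2 * ((N : ℝ) + 1) ^ 2 := by
        rw [← hρ a, abs_sub_comm]
        refine (hsum _ x).trans ?_
        have h3 : ((ρ a).length : ℝ) ≤ N + 1 := by
          rcases a with a | s
          · simp [hρH]
          · have : ((ρ (Sum.inr s)).length : ℝ) ≤ N := by exact_mod_cast hNU _ (hρX s)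
            linarith
        gcongr
      rw [List.flatMap_cons, wsum_append, hρ, stieltjesSum, add_sub_add_comm]
      refine (abs_add_le _ _).trans ?_
      push_cast [List.length_cons]
      linarith
  have h2 := hcmp w x
  have h3 := abs_add_le (stieltjesSum f g x w - wsum P Q x (w.flatMap ρ))
    (wsum P Q x (w.flatMap ρ))
  rw [sub_add_cancel] at h3
  have : 0 ≤ M ^ 2 * ((N : ℝ) + 1) ^ 2 := by positivity
  linarith

/-- The integral of `g df` along a closed edge path in the Cayley graph is bounded linearly in the
length of the path, for `1`-Lipschitz functions `f` and `g`. -/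
theorem exists_closed_path_bound (hXfin : X.Finite) (hXgen : Subgroup.closure X = ⊤)
    (hhyp : IsRelHyperbolic H) :
    ∃ K : ℝ, 0 ≤ K ∧ ∀ f g : G → ℝ, (∀ x y, |f x - f y| ≤ relDist H X x y) →
      (∀ x y, |g x - g y| ≤ relDist H X x y) →
      ∀ (z : ℕ → G) (n : ℕ), (∀ i < n, relDist H X (z i) (z (i + 1)) ≤ 1) → z n = z 0 →
        |∑ i ∈ Finset.range n, g (z i) * (f (z (i + 1)) - f (z i))| ≤ K * (n + 1) := by
  obtain ⟨K, hK, hmain⟩ := exists_stieltjesSum_bound hXfin hXgen hhyp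
  refine ⟨K, hK, fun f g hf hg z n hz hclosed => ?_⟩
  suffices h : ∀ m ≤ n, ∃ w : List (RelLetter H X), w.length ≤ m ∧ z 0 * wval w = z m ∧
      stieltjesSum f g (z 0) w = ∑ i ∈ Finset.range m, g (z i) * (f (z (i + 1)) - f (z i)) by
    obtain ⟨w, hw, hw1, hsum⟩ := h n le_rfl
    rw [← hsum]
    refine (hmain f g hf hg w (z 0) (by simpa [hclosed] using hw1)).trans ?_
    gcongr
  intro m
  induction m with
  | zero => exact fun _ => ⟨[], by simp [stieltjesSum]⟩
  | succ m ih =>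
    intro hm
    obtain ⟨w, hw, hw1, hsum⟩ := ih (by omega)
    obtain ⟨v, hv, hv1⟩ := exists_relWord (H := H) hXgen (z m) (z (m + 1))
    refine ⟨w ++ v, ?_, by rw [wval_append, ← mul_assoc, hw1, hv1], ?_⟩
    · have := hz m (by omega)
      simp
      omega
    · rw [stieltjesSum_append, hsum, Finset.sum_range_succ, hw1]
      congr 1
      rcases v with _ | ⟨a, v⟩
      · simp only [wval_nil, mul_one] at hv1
        simp [stieltjesSum, ← hv1]
      · have : v = [] := by
          have := hz m (by omega)
          simp only [List.length_cons] at hv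
          exact List.length_eq_zero_iff.1 (by omega)
        subst this
        simp only [wval_cons, wval_nil, mul_one] at hv1
        simp [stieltjesSum, hv1]

end Inequalities

section Morse

variable {V : Type*}

/-- A sequence of vertices with steps of size at most one and quasi-geodesic up to index `n`. -/
structure IsQuasiGeodesicSeq (d : V → V → ℝ) (lam c : ℝ) (x : ℕ → V) (n : ℕ) : Prop where
  step : ∀ i < n, d (x i) (x (i + 1)) ≤ 1
  bound : ∀ i j, i ≤ j → j ≤ n → (j : ℝ) - i ≤ lam * d (x i) (x j) + c

/-- The points `u` and `v` are joined by a discrete path of length at most `ℓ` through points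
satisfying `P`. -/
def JoinedBy (d : V → V → ℝ) (P : V → Prop) (u v : V) (ℓ : ℝ) : Prop :=
  ∃ (n : ℕ) (z : ℕ → V), (n : ℝ) ≤ ℓ ∧ z 0 = u ∧ z n = v ∧
    (∀ i < n, d (z i) (z (i + 1)) ≤ 1) ∧ ∀ i ≤ n, P (z i)

theorem dist_le_of_steps {d : V → V → ℝ} (hself : ∀ x, d x x = 0)
    (htri : ∀ x y z, d x z ≤ d x y + d y z) {z : ℕ → V} {n : ℕ}
    (hz : ∀ i < n, d (z i) (z (i + 1)) ≤ 1) : d (z 0) (z n) ≤ n := by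
  induction n with
  | zero => simp [hself]
  | succ n ih =>
    have h1 := ih fun i hi => hz i (by omega)
    have h2 := hz n (by omega)
    have h3 := htri (z 0) (z n) (z (n + 1))
    push_cast
    linarith

/-- Concatenation of the first `n` steps of `x` with `y`. -/
def concatSeq (x : ℕ → V) (n : ℕ) (y : ℕ → V) (i : ℕ) : V := if i ≤ n then x i else y (i - n)

theorem concatSeq_of_le {x y : ℕ → V} {n i : ℕ} (h : i ≤ n) : concatSeq x n y i = x i := if_pos h

theorem concatSeq_of_ge {x y : ℕ → V} {n i : ℕ} (hxy : x n = y 0) (h : n ≤ i) :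
    concatSeq x n y i = y (i - n) := by
  rcases h.eq_or_lt with rfl | h
  · simp [concatSeq, hxy]
  · exact if_neg (by omega)

theorem concatSeq_step {d : V → V → ℝ} {x y : ℕ → V} {n m : ℕ} (hxy : x n = y 0)
    (hx : ∀ i < n, d (x i) (x (i + 1)) ≤ 1) (hy : ∀ i < m, d (y i) (y (i + 1)) ≤ 1) :
    ∀ i < n + m, d (concatSeq x n y i) (concatSeq x n y (i + 1)) ≤ 1 := by
  intro i hi
  rcases lt_or_ge i n with h | h
  · rw [concatSeq_of_le h.le, concatSeq_of_le h]
    exact hx i h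
  · rw [concatSeq_of_ge hxy h, concatSeq_of_ge hxy (by omega),
      show i + 1 - n = i - n + 1 by omega]
    exact hy _ (by omega)

theorem JoinedBy.trans {d : V → V → ℝ} {P : V → Prop} {u v w : V} {ℓ ℓ' : ℝ}
    (h : JoinedBy d P u v ℓ) (h' : JoinedBy d P v w ℓ') : JoinedBy d P u w (ℓ + ℓ') := by
  obtain ⟨n, x, hn, rfl, rfl, hx, hxP⟩ := h
  obtain ⟨m, y, hm, hy0, rfl, hy, hyP⟩ := h'
  refine ⟨n + m, concatSeq x n y, by push_cast; linarith, concatSeq_of_le (Nat.zero_le _), ?_,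
    concatSeq_step hy0.symm hx hy, fun i hi => ?_⟩
  · rw [concatSeq_of_ge hy0.symm (by omega), Nat.add_sub_cancel_left]
  · rcases le_total i n with h | h
    · rw [concatSeq_of_le h]; exact hxP i h
    · rw [concatSeq_of_ge hy0.symm h]; exact hyP _ (by omega)

theorem JoinedBy.symm {d : V → V → ℝ} (hcomm : ∀ x y, d x y = d y x) {P : V → Prop} {u v : V}
    {ℓ : ℝ} (h : JoinedBy d P u v ℓ) : JoinedBy d P v u ℓ := by
  obtain ⟨n, x, hn, rfl, rfl, hx, hxP⟩ := h
  refine ⟨n, fun i => x (n - i), hn, by simp, by simp, fun i hi => ?_, fun i _ => hxP _ (by omega)⟩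
  have := hx (n - (i + 1)) (by omega)
  rw [hcomm]
  rwa [show n - (i + 1) + 1 = n - i by omega] at this

/-- The largest `1`-Lipschitz function whose value at `z i` is at most `h i` for all `i ≤ n`. -/
noncomputable def lipExt (d : V → V → ℝ) (z : ℕ → V) (n : ℕ) (h : ℕ → ℝ) (v : V) : ℝ :=
  (Finset.range (n + 1)).inf' ⟨0, by simp⟩ fun i => h i + d v (z i)

theorem lipExt_le {d : V → V → ℝ} (z : ℕ → V) {n : ℕ} (h : ℕ → ℝ) (v : V) {i : ℕ} (hi : i ≤ n) :
    lipExt d z n h v ≤ h i + d v (z i) :=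
  Finset.inf'_le (f := fun i => h i + d v (z i)) (Finset.mem_range.2 (by omega))

theorem le_lipExt {d : V → V → ℝ} {z : ℕ → V} {n : ℕ} {h : ℕ → ℝ} {v : V} {a : ℝ}
    (ha : ∀ i ≤ n, a ≤ h i + d v (z i)) : a ≤ lipExt d z n h v :=
  Finset.le_inf' _ _ fun i hi => ha i (by simpa [Nat.lt_succ_iff] using hi)

theorem abs_lipExt_sub_le {d : V → V → ℝ} (hcomm : ∀ x y, d x y = d y x)
    (htri : ∀ x y z, d x z ≤ d x y + d y z) (z : ℕ → V) (n : ℕ) (h : ℕ → ℝ) (v w : V) :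
    |lipExt d z n h v - lipExt d z n h w| ≤ d v w := by
  suffices key : ∀ v w, lipExt d z n h v - d v w ≤ lipExt d z n h w by
    have h1 := key v w
    have h2 := key w v
    rw [hcomm w v] at h2
    rw [abs_le]
    constructor <;> linarith
  intro v w
  refine le_lipExt fun i hi => ?_
  have h1 := lipExt_le (d := d) z h v hi
  have h2 := htri v w (z i)
  linarith

theorem abs_min_sub_min_le (E a b : ℝ) : |min E a - min E b| ≤ |a - b| := by
  simpa using abs_min_sub_min_le_max E a E b

/-- If a quasi-geodesic is closed up by a path that stays far from its `i₀`-th vertex, then the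
linear isoperimetric inequality forces the closed path to be long. -/
theorem sq_le_of_far {d : V → V → ℝ} (hself : ∀ x, d x x = 0) (hnonneg : ∀ x y, 0 ≤ d x y)
    (hcomm : ∀ x y, d x y = d y x) (htri : ∀ x y z, d x z ≤ d x y + d y z) {K : ℝ}
    (harea : ∀ f g : V → ℝ, (∀ x y, |f x - f y| ≤ d x y) → (∀ x y, |g x - g y| ≤ d x y) →
      ∀ (z : ℕ → V) (n : ℕ), (∀ i < n, d (z i) (z (i + 1)) ≤ 1) → z n = z 0 →
        |∑ i ∈ Finset.range n, g (z i) * (f (z (i + 1)) - f (z i))| ≤ K * (n + 1))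
    (hK : 0 ≤ K) {lam c : ℝ} (hlam : 1 ≤ lam) (hc : 0 ≤ c) {x : ℕ → V} {n : ℕ}
    (hx : IsQuasiGeodesicSeq d lam c x n) {i₀ : ℕ} (hi₀ : i₀ ≤ n) {E : ℝ} (hE : 0 ≤ E) {ℓ : ℝ}
    (hrest : JoinedBy d (fun v => lam * E ≤ d v (x i₀)) (x n) (x 0) ℓ) :
    E ^ 2 / 2 ≤ K * (n + ℓ + 1) + (c + 1) * n := by
  have hlam0 : 0 < lam := by linarith
  obtain ⟨m, y, hm, hy0, hym, hy, hyP⟩ := hrest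
  set z := concatSeq x n y with hz
  have hzx : ∀ i ≤ n, z i = x i := fun i hi => concatSeq_of_le hi
  have hzy : ∀ i, n ≤ i → z i = y (i - n) := fun i hi => concatSeq_of_ge hy0.symm hi
  have hzstep := concatSeq_step hy0.symm hx.step hy
  have hclosed : z (n + m) = z 0 := by
    rw [hzy _ (by omega), hzx 0 (by omega), Nat.add_sub_cancel_left, hym]
  let h₁ : ℕ → ℝ := fun i => |(i : ℝ) - i₀| / lam
  let h₂ : ℕ → ℝ := fun i => max ((i : ℝ) - i₀) 0 / lam
  let f : V → ℝ := fun v => min E (lipExt d x n h₁ v)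
  let g : V → ℝ := fun v => min E (lipExt d x n h₂ v)
  have hf : ∀ v w, |f v - f w| ≤ d v w := fun v w =>
    (abs_min_sub_min_le _ _ _).trans (abs_lipExt_sub_le hcomm htri _ _ _ _ _)
  have hg : ∀ v w, |g v - g w| ≤ d v w := fun v w =>
    (abs_min_sub_min_le _ _ _).trans (abs_lipExt_sub_le hcomm htri _ _ _ _ _)
  have hqg : ∀ i ≤ n, ∀ j ≤ n, |(i : ℝ) - j| ≤ lam * d (x i) (x j) + c := by
    intro i hi j hj
    rcases le_total i j with h | h
    · have h1 : (i : ℝ) ≤ j := by exact_mod_cast h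
      rw [abs_sub_comm, abs_of_nonneg (by linarith)]
      exact hx.bound i j h hj
    · have h1 : (j : ℝ) ≤ i := by exact_mod_cast h
      rw [abs_of_nonneg (by linarith), hcomm]
      exact hx.bound j i h hi
  have hdist : ∀ i ≤ n, ∀ j ≤ n, d (x i) (x j) ≤ |(i : ℝ) - j| := by
    have key : ∀ i k, i + k ≤ n → d (x i) (x (i + k)) ≤ k := fun i k hk =>
      dist_le_of_steps hself htri (z := fun t => x (i + t)) fun t ht => hx.step (i + t) (by omega)
    intro i hi j hj
    rcases le_total i j with h | h
    · obtain ⟨k, rfl⟩ := Nat.exists_eq_add_of_le h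
      have := key i k hj
      rw [abs_sub_comm]
      simpa using this
    · obtain ⟨k, rfl⟩ := Nat.exists_eq_add_of_le h
      have := key j k hi
      rw [hcomm]
      simpa using this
  -- lower bounds along the quasi-geodesic
  have hlow : ∀ (h : ℕ → ℝ), (∀ i j, h i ≤ h j + |(i : ℝ) - j| / lam) → ∀ i ≤ n,
      h i - c ≤ lipExt d x n h (x i) := by
    intro h hh i hi
    refine le_lipExt fun j hj => ?_
    have h1 := hh i j
    have h2 : |(i : ℝ) - j| / lam ≤ d (x i) (x j) + c := by
      rw [div_le_iff₀ hlam0]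
      have := hqg i hi j hj
      nlinarith
    linarith
  have hup : ∀ (h : ℕ → ℝ), ∀ i ≤ n, lipExt d x n h (x i) ≤ h i := by
    intro h i hi
    have := lipExt_le (d := d) x h (x i) hi
    rwa [hself, add_zero] at this
  have hh₁ : ∀ i j : ℕ, h₁ i ≤ h₁ j + |(i : ℝ) - j| / lam := by
    intro i j
    simp only [h₁]
    rw [← add_div]
    gcongr
    have := abs_sub_le (i : ℝ) j i₀
    linarith
  have hh₂ : ∀ i j : ℕ, h₂ i ≤ h₂ j + |(i : ℝ) - j| / lam := by
    intro i j
    simp only [h₂]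
    rw [← add_div]
    gcongr
    have h1 := le_abs_self ((i : ℝ) - j)
    have h2 := le_max_left ((j : ℝ) - i₀) 0
    have h3 := le_max_right ((j : ℝ) - i₀) 0
    have h4 := abs_nonneg ((i : ℝ) - j)
    exact max_le (by linarith) (by linarith)
  have hgf : ∀ i, i₀ ≤ i → i ≤ n → |g (x i) - f (x i)| ≤ c := by
    intro i hi hin
    have h0 : (i₀ : ℝ) ≤ i := by exact_mod_cast hi
    have h1 : h₁ i = h₂ i := by
      simp only [h₁, h₂]
      rw [abs_of_nonneg (by linarith), max_eq_left (by linarith)]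
    refine (abs_min_sub_min_le _ _ _).trans ?_
    have a1 := hlow h₁ hh₁ i hin
    have a2 := hlow h₂ hh₂ i hin
    have a3 := hup h₁ i hin
    have a4 := hup h₂ i hin
    rw [abs_le]
    constructor <;> linarith
  have hgzero : ∀ i ≤ i₀, g (x i) = 0 := by
    intro i hi
    have h0 : (i : ℝ) ≤ i₀ := by exact_mod_cast hi
    have a1 := hup h₂ i (hi.trans hi₀)
    have a2 : h₂ i = 0 := by
      simp only [h₂]
      rw [max_eq_right (by linarith), zero_div]
    have a3 : 0 ≤ lipExt d x n h₂ (x i) := le_lipExt fun j hj =>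
      add_nonneg (div_nonneg (le_max_right _ _) hlam0.le) (hnonneg _ _)
    have a4 : lipExt d x n h₂ (x i) = 0 := le_antisymm (a2 ▸ a1) a3
    simp only [g, a4]
    exact min_eq_right hE
  have hfi₀ : f (x i₀) = 0 := by
    have a1 := hup h₁ i₀ hi₀
    have a2 : h₁ i₀ = 0 := by simp [h₁]
    have a3 : 0 ≤ lipExt d x n h₁ (x i₀) := le_lipExt fun j hj =>
      add_nonneg (div_nonneg (abs_nonneg _) hlam0.le) (hnonneg _ _)
    have a4 : lipExt d x n h₁ (x i₀) = 0 := le_antisymm (a2 ▸ a1) a3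
    simp only [f, a4]
    exact min_eq_right hE
  have hffar : ∀ i, n ≤ i → i ≤ n + m → f (z i) = E := by
    intro i hi him
    have h1 := hyP (i - n) (by omega)
    rw [← hzy i hi] at h1
    refine min_eq_left (le_lipExt fun j hj => ?_)
    have h2 := htri (z i) (x j) (x i₀)
    have h3 := hdist j hj i₀ hi₀
    have h4 : d (z i) (x j) / lam ≤ d (z i) (x j) := div_le_self (hnonneg _ _) hlam
    have h5 : E ≤ (|(j : ℝ) - i₀| + d (z i) (x j)) / lam := by
      rw [le_div_iff₀ hlam0]; linarith
    rw [add_div] at h5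
    simp only [h₁]
    linarith
  -- the main lower estimate for the integral
  let s : ℕ → ℝ := fun i => if i₀ ≤ i then f (z i) ^ 2 / 2 else 0
  have hsum : ∀ k ≤ n + m, s k - (c + 1) * (min k n : ℕ) ≤
      ∑ i ∈ Finset.range k, g (z i) * (f (z (i + 1)) - f (z i)) := by
    intro k
    induction k with
    | zero =>
      intro _
      simp only [s]
      split_ifs with h
      · have h0 : i₀ = 0 := by omega
        subst h0
        simp [hzx 0 (by omega), hfi₀]
      · simp
    | succ k ih =>
      intro hk
      have ih := ih (by omega)
      rw [Finset.sum_range_succ]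
      rcases lt_or_ge k i₀ with hki | hki
      · rw [hzx k (by omega), hgzero k hki.le, zero_mul, add_zero]
        refine le_trans ?_ ih
        have h1 : s (k + 1) = 0 := by
          simp only [s]
          split_ifs with h
          · have h0 : i₀ = k + 1 := by omega
            rw [← h0, hzx i₀ hi₀, hfi₀]
            norm_num
          · rfl
        have h2 : s k = 0 := if_neg (by omega)
        rw [h1, h2]
        have h3 : ((min k n : ℕ) : ℝ) ≤ (min (k + 1) n : ℕ) := by
          exact_mod_cast (by omega : min k n ≤ min (k + 1) n)
        nlinarith
      · have hs : ∀ j, k ≤ j → s j = f (z j) ^ 2 / 2 := fun j hj => if_pos (by omega)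
        rw [hs _ le_rfl] at ih
        rw [hs _ (Nat.le_succ k)]
        rcases lt_or_ge k n with hkn | hkn
        · rw [min_eq_left hkn.le] at ih
          rw [min_eq_left (show k + 1 ≤ n by omega)]
          push_cast
          have b1 : |f (z (k + 1)) - f (z k)| ≤ 1 := by
            rw [abs_sub_comm]; exact (hf _ _).trans (hzstep k (by omega))
          have b2 : |g (z k) - f (z k)| ≤ c := by
            rw [hzx k hkn.le]; exact hgf k hki hkn.le
          have b3 : |(g (z k) - f (z k)) * (f (z (k + 1)) - f (z k))| ≤ c * 1 := by
            rw [abs_mul]; exact mul_le_mul b2 b1 (abs_nonneg _) hc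
          have b4 := neg_le_of_abs_le b3
          have b5 : (f (z (k + 1)) - f (z k)) ^ 2 ≤ 1 := by
            rw [← sq_abs]; nlinarith [abs_nonneg (f (z (k + 1)) - f (z k))]
          nlinarith
        · rw [min_eq_right hkn] at ih
          rw [min_eq_right (show n ≤ k + 1 by omega), hffar (k + 1) (by omega) hk,
            hffar k hkn (by omega)]
          rw [hffar k hkn (by omega)] at ih
          linarith
  have h1 := hsum (n + m) le_rfl
  have h2 := harea f g hf hg z (n + m) hzstep hclosed
  have h3 : s (n + m) = E ^ 2 / 2 := by
    simp only [s]
    rw [if_pos (by omega), hffar _ (by omega) le_rfl]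
  rw [h3, min_eq_right (by omega)] at h1
  have h4 := (le_abs_self _).trans h2
  push_cast at h4
  have h5 : K * ((n : ℝ) + m + 1) ≤ K * (n + ℓ + 1) := by gcongr
  linarith

/-- Stability of quasi-geodesics under the linear isoperimetric inequality. -/
theorem exists_quasiGeodesic_stability {d : V → V → ℝ} (hself : ∀ x, d x x = 0)
    (hnonneg : ∀ x y, 0 ≤ d x y)
    (hcomm : ∀ x y, d x y = d y x) (htri : ∀ x y z, d x z ≤ d x y + d y z)
    (hgeo : ∀ x y, ∃ (n : ℕ) (z : ℕ → V), (n : ℝ) ≤ d x y ∧ z 0 = x ∧ z n = y ∧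
      ∀ i < n, d (z i) (z (i + 1)) ≤ 1) {K : ℝ}
    (harea : ∀ f g : V → ℝ, (∀ x y, |f x - f y| ≤ d x y) → (∀ x y, |g x - g y| ≤ d x y) →
      ∀ (z : ℕ → V) (n : ℕ), (∀ i < n, d (z i) (z (i + 1)) ≤ 1) → z n = z 0 →
        |∑ i ∈ Finset.range n, g (z i) * (f (z (i + 1)) - f (z i))| ≤ K * (n + 1))
    (hK : 0 ≤ K) {lam c κ : ℝ} (hlam : 1 ≤ lam) (hc : 0 ≤ c) (hκ : 0 ≤ κ) :
    ∃ D : ℝ, 0 ≤ D ∧ ∀ (x y : ℕ → V) (n m : ℕ), IsQuasiGeodesicSeq d lam c x n →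
      IsQuasiGeodesicSeq d lam c y m → d (x 0) (y 0) ≤ κ → d (x n) (y m) ≤ κ →
      ∀ i ≤ n, ∃ j ≤ m, d (x i) (y j) ≤ D := by
  have hlam0 : 0 < lam := by linarith
  set α : ℝ := K * ((2 + 2 * lam) * (2 * lam + 1)) + (c + 1) * (4 * lam) with hα
  set β : ℝ := K * ((2 + 2 * lam) * (c + 1) + c + 1) + 2 * (c + 1) ^ 2 with hβ
  have hα0 : 0 ≤ α := by positivity
  have hβ0 : 0 ≤ β := by positivity
  refine ⟨2 * κ + 1 + 8 * lam ^ 2 * (α + β), by positivity, ?_⟩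
  intro x y n m hx hy h0 h1
  let δ : ℕ → ℝ := fun i => (Finset.range (m + 1)).inf' ⟨0, by simp⟩ fun j => d (x i) (y j)
  have hδle : ∀ i, ∀ j ≤ m, δ i ≤ d (x i) (y j) := fun i j hj =>
    Finset.inf'_le (f := fun j => d (x i) (y j)) (Finset.mem_range.2 (by omega))
  have hδex : ∀ i, ∃ j ≤ m, d (x i) (y j) = δ i := by
    intro i
    obtain ⟨j, hj, hj'⟩ := Finset.exists_mem_eq_inf' (s := Finset.range (m + 1)) ⟨0, by simp⟩
      fun j => d (x i) (y j)
    exact ⟨j, by simpa [Nat.lt_succ_iff] using hj, hj'.symm⟩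
  obtain ⟨i₀, hi₀, hmax⟩ := Finset.exists_max_image (Finset.range (n + 1)) δ ⟨0, by simp⟩
  have hi₀n : i₀ ≤ n := by simpa [Nat.lt_succ_iff] using hi₀
  have hmax' : ∀ i ≤ n, δ i ≤ δ i₀ := fun i hi => hmax i (by simpa [Nat.lt_succ_iff] using hi)
  suffices hD : δ i₀ ≤ 2 * κ + 1 + 8 * lam ^ 2 * (α + β) by
    intro i hi
    obtain ⟨j, hj, hj'⟩ := hδex i
    exact ⟨j, hj, hj' ▸ (hmax' i hi).trans hD⟩
  by_contra! hD
  set D := δ i₀ with hDdef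
  have hαβ : 0 ≤ 8 * lam ^ 2 * (α + β) := by positivity
  have hD1 : 1 ≤ D := by linarith
  have hDκ : 2 * κ ≤ D := by linarith
  obtain ⟨L, hL1, hL2⟩ : ∃ L : ℕ, 2 * lam * D + c ≤ L ∧ (L : ℝ) ≤ 2 * lam * D + c + 1 :=
    ⟨⌈2 * lam * D + c⌉₊, Nat.le_ceil _, (Nat.ceil_lt_add_one (by positivity)).le⟩
  have hfary : ∀ j ≤ m, D ≤ d (y j) (x i₀) := fun j hj => hcomm (x i₀) (y j) ▸ hδle i₀ j hj
  -- segments joining far away vertices to the second path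
  have hseg : ∀ i j, i ≤ n → j ≤ m → d (x i) (y j) ≤ D →
      (d (x i) (y j) ≤ κ ∨ D / 2 + D ≤ d (x i) (x i₀)) →
      JoinedBy d (fun v => D / 2 ≤ d v (x i₀)) (x i) (y j) D := by
    intro i j hi hj hij hcase
    obtain ⟨r, z, hr, hz0, hzr, hz⟩ := hgeo (x i) (y j)
    have hz1 : ∀ t ≤ r, d (x i) (z t) ≤ t := by
      intro t
      induction t with
      | zero => simp [hz0, hself]
      | succ t ih =>
        intro ht
        have a1 := ih (by omega)
        have a2 := hz t (by omega)
        have a3 := htri (x i) (z t) (z (t + 1))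
        push_cast
        linarith
    have hz2 : ∀ t ≤ r, d (z (r - t)) (y j) ≤ t := by
      intro t
      induction t with
      | zero => simp [hzr, hself]
      | succ t ih =>
        intro ht
        have a1 := ih (by omega)
        have a2 := hz (r - (t + 1)) (by omega)
        rw [show r - (t + 1) + 1 = r - t by omega] at a2
        have a3 := htri (z (r - (t + 1))) (z (r - t)) (y j)
        push_cast
        linarith
    refine ⟨r, z, hr.trans hij, hz0, hzr, hz, fun t ht => ?_⟩
    rcases hcase with hcase | hcase
    · have a1 := hz2 (r - t) (by omega)
      rw [show r - (r - t) = t by omega] at a1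
      have a2 : ((r - t : ℕ) : ℝ) ≤ r := by exact_mod_cast Nat.sub_le r t
      have a3 := htri (y j) (z t) (x i₀)
      have a4 := hfary j hj
      rw [hcomm (y j) (z t)] at a3
      linarith
    · have a1 := hz1 t ht
      have a2 : (t : ℝ) ≤ r := by exact_mod_cast ht
      have a3 := htri (x i) (z t) (x i₀)
      linarith
  have hfarx : ∀ i ≤ n, (L : ℝ) ≤ |(i : ℝ) - i₀| → D / 2 + D ≤ d (x i) (x i₀) := by
    intro i hi hiL
    have a1 : |(i : ℝ) - i₀| ≤ lam * d (x i) (x i₀) + c := by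
      rcases le_total i i₀ with h | h
      · have a0 : (i : ℝ) ≤ i₀ := by exact_mod_cast h
        rw [abs_sub_comm, abs_of_nonneg (by linarith)]
        exact hx.bound i i₀ h hi₀n
      · have a0 : (i₀ : ℝ) ≤ i := by exact_mod_cast h
        rw [abs_of_nonneg (by linarith), hcomm]
        exact hx.bound i₀ i h hi
    have a2 : lam * (2 * D) ≤ lam * d (x i) (x i₀) := by linarith
    have a3 := le_of_mul_le_mul_left a2 hlam0
    linarith
  obtain ⟨a, ha, haL, ja, hja, hsega⟩ : ∃ a ≤ i₀, i₀ ≤ a + L ∧ ∃ ja ≤ m,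
      JoinedBy d (fun v => D / 2 ≤ d v (x i₀)) (x a) (y ja) D := by
    rcases le_total i₀ L with h | h
    · exact ⟨0, Nat.zero_le _, by omega, 0, Nat.zero_le _,
        hseg 0 0 (Nat.zero_le _) (Nat.zero_le _) (by linarith) (Or.inl h0)⟩
    · obtain ⟨j, hj, hj'⟩ := hδex (i₀ - L)
      refine ⟨i₀ - L, by omega, by omega, j, hj, hseg _ j (by omega) hj
        (hj' ▸ hmax' _ (by omega)) (Or.inr (hfarx _ (by omega) ?_))⟩
      rw [Nat.cast_sub h, abs_sub_comm]
      exact le_trans (le_of_eq (by ring)) (le_abs_self _)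
  obtain ⟨b, hb, hbn, hbL, jb, hjb, hsegb⟩ : ∃ b, i₀ ≤ b ∧ b ≤ n ∧ b ≤ i₀ + L ∧ ∃ jb ≤ m,
      JoinedBy d (fun v => D / 2 ≤ d v (x i₀)) (x b) (y jb) D := by
    rcases le_total n (i₀ + L) with h | h
    · exact ⟨n, hi₀n, le_rfl, h, m, le_rfl,
        hseg n m le_rfl le_rfl (by linarith) (Or.inl h1)⟩
    · obtain ⟨j, hj, hj'⟩ := hδex (i₀ + L)
      refine ⟨i₀ + L, by omega, h, le_rfl, j, hj, hseg _ j h hj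
        (hj' ▸ hmax' _ h) (Or.inr (hfarx _ h ?_))⟩
      push_cast
      exact le_trans (le_of_eq (by ring)) (le_abs_self _)
  have hlen : ∀ u v (ℓ : ℝ), JoinedBy d (fun v => D / 2 ≤ d v (x i₀)) u v ℓ → d u v ≤ ℓ := by
    rintro u v ℓ ⟨r, z, hr, rfl, rfl, hz, -⟩
    exact (dist_le_of_steps hself htri hz).trans hr
  have hshift : IsQuasiGeodesicSeq d lam c (fun i => x (a + i)) (b - a) :=
    ⟨fun i hi => hx.step (a + i) (by omega), fun i j hij hj => by
      have := hx.bound (a + i) (a + j) (by omega) (by omega)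
      push_cast at this
      linarith⟩
  have hba : ((b - a : ℕ) : ℝ) ≤ 2 * L := by
    exact_mod_cast (by omega : b - a ≤ 2 * L)
  have hdab : d (x a) (x b) ≤ 2 * L := by
    have a1 := dist_le_of_steps hself htri hshift.step
    simp only [add_zero, show a + (b - a) = b by omega] at a1
    exact a1.trans hba
  have hyseg : ∀ j j', j ≤ j' → j' ≤ m → JoinedBy d (fun v => D / 2 ≤ d v (x i₀)) (y j) (y j')
      (lam * d (y j) (y j') + c) := by
    intro j j' hjj hj'
    refine ⟨j' - j, fun t => y (j + t), ?_, by simp, by simp [show j + (j' - j) = j' by omega],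
      fun t ht => hy.step (j + t) (by omega), fun t ht => ?_⟩
    · rw [Nat.cast_sub hjj]
      exact hy.bound j j' hjj hj'
    · have := hfary (j + t) (by omega)
      linarith
  have hymid : JoinedBy d (fun v => D / 2 ≤ d v (x i₀)) (y jb) (y ja)
      (lam * (2 * L + 2 * D) + c) := by
    have hd : d (y jb) (y ja) ≤ 2 * L + 2 * D := by
      have a1 := hlen _ _ _ hsega
      have a2 := hlen _ _ _ hsegb
      have a3 := htri (y jb) (x b) (y ja)
      have a4 := htri (x b) (x a) (y ja)
      rw [hcomm (y jb) (x b)] at a3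
      rw [hcomm (x b) (x a)] at a4
      linarith
    have hmono : lam * d (y jb) (y ja) + c ≤ lam * (2 * L + 2 * D) + c := by gcongr
    have hj : JoinedBy d (fun v => D / 2 ≤ d v (x i₀)) (y jb) (y ja)
        (lam * d (y jb) (y ja) + c) := by
      rcases le_total jb ja with h | h
      · exact hyseg _ _ h hja
      · rw [hcomm (y jb)]
        exact (hyseg _ _ h hjb).symm hcomm
    obtain ⟨r, z, hr, hz⟩ := hj
    exact ⟨r, z, hr.trans hmono, hz⟩
  have hrest := (hsegb.trans hymid).trans (hsega.symm hcomm)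
  have key := sq_le_of_far hself hnonneg hcomm htri harea hK hlam hc hshift
    (i₀ := i₀ - a) (by omega) (E := D / (2 * lam)) (by positivity)
    (ℓ := D + (lam * (2 * L + 2 * D) + c) + D) (by
      simp only [show a + (b - a) = b by omega, show a + (i₀ - a) = i₀ by omega, add_zero]
      rwa [show lam * (D / (2 * lam)) = D / 2 by field_simp])
  have hfin : D ^ 2 / (8 * lam ^ 2) ≤ α * D + β := by
    have e1 : (D / (2 * lam)) ^ 2 / 2 = D ^ 2 / (8 * lam ^ 2) := by
      field_simp; norm_num
    rw [e1] at key
    refine key.trans ?_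
    have e2 : ((b - a : ℕ) : ℝ) + (D + (lam * (2 * L + 2 * D) + c) + D) + 1 ≤
        (2 + 2 * lam) * (2 * lam + 1) * D + ((2 + 2 * lam) * (c + 1) + c + 1) := by
      have : lam * L ≤ lam * (2 * lam * D + c + 1) := by gcongr
      nlinarith
    have e3 := mul_le_mul_of_nonneg_left e2 hK
    have e4 : (c + 1) * ((b - a : ℕ) : ℝ) ≤ (c + 1) * (2 * (2 * lam * D + c + 1)) := by
      gcongr
      linarith
    have e5 : α * D + β = K * ((2 + 2 * lam) * (2 * lam + 1) * D +
        ((2 + 2 * lam) * (c + 1) + c + 1)) + (c + 1) * (2 * (2 * lam * D + c + 1)) := by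
      rw [hα, hβ]; ring
    rw [e5]
    linarith
  rw [div_le_iff₀ (by positivity)] at hfin
  have h2 : α * D + β ≤ (α + β) * D := by nlinarith
  have h3 : D * D ≤ (8 * lam ^ 2 * (α + β)) * D := by
    have : 0 ≤ 8 * lam ^ 2 := by positivity
    nlinarith
  have h4 := le_of_mul_le_mul_right h3 (by linarith)
  linarith

end Morse

section Routes

variable {G : Type*} [Group G] {Λ : Type*} {H : Λ → Subgroup G} {X : Set G}

/-- There is a word of length at most `n` labelling a path from `x` to `y` on which the coboundary
of `P` on `𝓗`-edges takes the value `S`. -/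
def Route (H : Λ → Subgroup G) (X : Set G) (P : Λ → G → ℝ) (x y : G) (n : ℕ) (S : ℝ) : Prop :=
  ∃ w : List (RelLetter H X), w.length ≤ n ∧ x * wval w = y ∧ wsum P 0 x w = S

namespace Route

variable {P : Λ → G → ℝ} {x y z : G} {n m : ℕ} {S T : ℝ}

theorem refl (x : G) : Route H X P x x 0 0 := ⟨[], by simp⟩

theorem trans (h : Route H X P x y n S) (h' : Route H X P y z m T) :
    Route H X P x z (n + m) (S + T) := by
  obtain ⟨u, hu, rfl, rfl⟩ := h
  obtain ⟨v, hv, rfl, rfl⟩ := h'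
  exact ⟨u ++ v, by simp; omega, by simp [mul_assoc], by rw [wsum_append]⟩

theorem mono (h : Route H X P x y n S) (hnm : n ≤ m) : Route H X P x y m S := by
  obtain ⟨u, hu, h1, h2⟩ := h
  exact ⟨u, hu.trans hnm, h1, h2⟩

theorem of_letter (x : G) (a : RelLetter H X) :
    Route H X P x (x * a.val) 1 (letterWeight P 0 x a) := ⟨[a], by simp⟩

theorem letter_symm (x : G) (a : RelLetter H X) :
    Route H X P (x * a.val) x 1 (-letterWeight P 0 x a) := by
  rcases a with ⟨l, h, hh⟩ | ⟨s, b⟩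
  · refine ⟨[Sum.inl ⟨l, h⁻¹, by simpa using hh⟩], ?_⟩
    simp [RelLetter.val, letterWeight]
  · refine ⟨[Sum.inr (s, !b)], ?_⟩
    cases b <;> simp [RelLetter.val, letterWeight]

theorem symm (h : Route H X P x y n S) : Route H X P y x n (-S) := by
  obtain ⟨w, hw, rfl, rfl⟩ := h
  refine Route.mono ?_ hw
  clear hw
  induction w generalizing x with
  | nil => simpa using refl x
  | cons a w ih =>
    have := (ih (x := x * a.val)).trans (letter_symm x a)
    rw [wval_cons, ← mul_assoc, wsum_cons, neg_add_rev]
    exact this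

theorem symm_zero (h : Route H X P x y n 0) : Route H X P y x n 0 := by
  simpa using h.symm

theorem trans_zero (h : Route H X P x y n 0) (h' : Route H X P y z m 0) :
    Route H X P x z (n + m) 0 := by
  simpa using h.trans h'

theorem letterWeight_eq_zero {l : Λ} {g : G} {φ : G → ℝ} {x : G} {a : RelLetter H X}
    (ha : a.hIndex = some l → g⁻¹ * x ∉ H l) :
    letterWeight (cosetFn H l g φ) 0 x a = 0 := by
  rcases a with ⟨l', h⟩ | ⟨s, b⟩
  · have h1 : l' = l → g⁻¹ * x ∉ H l := by
      rintro rfl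
      exact ha rfl
    have h2 : l' = l → g⁻¹ * (x * h.1) ∉ H l := by
      rintro rfl hm
      refine h1 rfl ?_
      rw [← mul_assoc] at hm
      exact ((H l').mul_mem_cancel_right h.1.2).1 hm
    simp only [letterWeight, cosetFn]
    rw [if_neg fun h' => h2 h'.1 h'.2, if_neg fun h' => h1 h'.1 h'.2, sub_zero]
  · simp [letterWeight]

theorem of_word {l : Λ} {g : G} {φ : G → ℝ} {x : G} {w : List (RelLetter H X)}
    (hw : ∀ u a v, w = u ++ a :: v → a.hIndex = some l → g⁻¹ * (x * wval u) ∉ H l) :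
    Route H X (cosetFn H l g φ) x (x * wval w) w.length 0 := by
  refine ⟨w, le_rfl, rfl, ?_⟩
  induction w generalizing x with
  | nil => simp
  | cons a w ih =>
    rw [wsum_cons, letterWeight_eq_zero fun h => by simpa using hw [] a w rfl h, zero_add]
    refine ih fun u b v huv hb => ?_
    have := hw (a :: u) b v (by simp [huv]) hb
    rwa [wval_cons, ← mul_assoc x] at this

theorem exists_letter {l : Λ} {x y : G} (h : x⁻¹ * y ∈ H l) (hxy : x ≠ y) :
    ∃ a : RelLetter H X, a.hIndex = some l ∧ x * a.val = y :=
  ⟨Sum.inl ⟨l, ⟨_, h⟩, fun h1 => hxy (by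
    have h2 := congrArg Subtype.val h1
    simpa [inv_mul_eq_one] using h2)⟩, rfl, by simp [RelLetter.val]⟩

theorem of_mem {l : Λ} {g : G} {φ : G → ℝ} {x y : G} (hx : g⁻¹ * x ∈ H l) (h : x⁻¹ * y ∈ H l) :
    Route H X (cosetFn H l g φ) x y 1 (φ y - φ x) := by
  by_cases hxy : x = y
  · subst hxy
    simpa using (refl x).mono zero_le_one
  · have hy : g⁻¹ * y ∈ H l := by simpa [mul_assoc] using (H l).mul_mem hx h
    refine ⟨[Sum.inl ⟨l, ⟨_, h⟩, fun h1 => hxy ?_⟩], by simp, by simp [RelLetter.val], ?_⟩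
    · have h2 := congrArg Subtype.val h1
      simpa [inv_mul_eq_one] using h2
    · simp [letterWeight, cosetFn, hx, hy]

theorem of_mem_of_avoid {l l' : Λ} {g : G} {φ : G → ℝ} {x y : G} (h : x⁻¹ * y ∈ H l')
    (hx : l' = l → g⁻¹ * x ∉ H l) : Route H X (cosetFn H l g φ) x y 1 0 := by
  by_cases hxy : x = y
  · subst hxy
    exact (refl x).mono zero_le_one
  · obtain ⟨a, ha, rfl⟩ := exists_letter (X := X) h hxy
    have := of_letter (P := cosetFn H l g φ) x a
    rwa [letterWeight_eq_zero fun hl => hx (Option.some.inj (ha.symm.trans hl))] at this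

end Route

end Routes

section Paths

variable {G : Type*} [Group G] {Λ : Type*} {H : Λ → Subgroup G} {X : Set G} {p q : RelPath H X}
  {l : Λ}

theorem RelPath.vertex_zero (p : RelPath H X) : p.vertex 0 = p.start := by
  simp [RelPath.vertex]

theorem RelPath.exists_letter (p : RelPath H X) {t : ℕ} (ht : t < p.len) :
    ∃ a, p.word[t]? = some a ∧ p.vertex (t + 1) = p.vertex t * a.val := by
  have ht' : t < p.word.length := ht
  refine ⟨p.word[t], by simp, ?_⟩
  rw [RelPath.vertex, RelPath.vertex, List.take_add_one, List.getElem?_eq_getElem ht',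
    Option.toList_some, List.map_append, List.prod_append, mul_assoc]
  simp

theorem val_mem_of_hIndex {a : RelLetter H X} (ha : a.hIndex = some l) : a.val ∈ H l := by
  rcases a with ⟨l', h⟩ | ⟨s, c⟩
  · obtain rfl : l' = l := Option.some.inj ha
    exact h.1.2
  · simp [RelLetter.hIndex] at ha

theorem LetterIsH.lt_len {t : ℕ} (h : LetterIsH p l t) : t < p.len := by
  obtain ⟨a, ha, -⟩ := h
  exact (List.getElem?_eq_some_iff.1 ha).1

theorem LetterIsH.mem {t : ℕ} (h : LetterIsH p l t) :
    (p.vertex t)⁻¹ * p.vertex (t + 1) ∈ H l := by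
  obtain ⟨b, hb, hv⟩ := p.exists_letter h.lt_len
  obtain ⟨a, ha, hl⟩ := h
  obtain rfl : a = b := Option.some.inj (ha.symm.trans hb)
  rw [hv, inv_mul_cancel_left]
  exact val_mem_of_hIndex hl

theorem LetterIsH.index_unique {l' : Λ} {t : ℕ} (h : LetterIsH p l t) (h' : LetterIsH p l' t) :
    l = l' := by
  obtain ⟨a, ha, hl⟩ := h
  obtain ⟨b, hb, hl'⟩ := h'
  obtain rfl : a = b := Option.some.inj (ha.symm.trans hb)
  exact Option.some.inj (hl.symm.trans hl')

theorem mem_of_letters {a b : ℕ} (hab : a ≤ b) (h : ∀ k, a ≤ k → k < b → LetterIsH p l k) :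
    (p.vertex a)⁻¹ * p.vertex b ∈ H l := by
  induction b, hab using Nat.le_induction with
  | base => simp
  | succ b hab ih =>
    have h1 := ih fun k hk hk' => h k hk (by omega)
    have h2 := (h b hab (by omega)).mem
    simpa [mul_assoc] using (H l).mul_mem h1 h2

theorem IsComponent.mem {a b t : ℕ} (h : IsComponent p l a b) (hat : a ≤ t) (htb : t ≤ b + 1) :
    (p.vertex a)⁻¹ * p.vertex t ∈ H l :=
  mem_of_letters hat fun k hk hk' => h.2.2.1 k hk (by omega)

theorem LetterIsH.exists_isComponent {t : ℕ} (h : LetterIsH p l t) :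
    ∃ a b, IsComponent p l a b ∧ a ≤ t ∧ t ≤ b := by
  classical
  have hex : ∃ a, a ≤ t ∧ ∀ k, a ≤ k → k ≤ t → LetterIsH p l k :=
    ⟨t, le_rfl, fun k h1 h2 => by rwa [le_antisymm h2 h1]⟩
  have hb0 : ∀ k, t ≤ k → k ≤ t → LetterIsH p l k := fun k h1 h2 => by rwa [le_antisymm h2 h1]
  obtain ⟨ha1, ha2⟩ := Nat.find_spec hex
  have ha3 := fun m (hm : m < Nat.find hex) => Nat.find_min hex hm
  set a := Nat.find hex
  have hbmax := Nat.findGreatest_spec (P := fun b => t ≤ b ∧ ∀ k, t ≤ k → k ≤ b → LetterIsH p l k)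
    h.lt_len.le ⟨le_rfl, hb0⟩
  have hbg := fun k => Nat.findGreatest_is_greatest (n := p.len) (k := k)
    (P := fun b => t ≤ b ∧ ∀ k, t ≤ k → k ≤ b → LetterIsH p l k)
  set b := Nat.findGreatest (fun b => t ≤ b ∧ ∀ k, t ≤ k → k ≤ b → LetterIsH p l k) p.len
  obtain ⟨hb1, hb2⟩ := hbmax
  have hblt := (hb2 b hb1 le_rfl).lt_len
  refine ⟨a, b, ⟨by omega, hblt, fun k hk hk' => ?_, ?_, ?_⟩, ha1, hb1⟩
  · rcases le_total k t with h1 | h1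
    · exact ha2 k hk h1
    · exact hb2 k h1 hk'
  · rcases Nat.eq_zero_or_pos a with h0 | h0
    · exact Or.inl h0
    · refine Or.inr fun hl => ha3 (a - 1) (by omega) ⟨by omega, fun k hk hk' => ?_⟩
      rcases eq_or_lt_of_le hk with rfl | hk
      · exact hl
      · exact ha2 k (by omega) hk'
  · refine or_iff_not_imp_left.2 fun hne hl => hbg (b + 1) (by omega) (by omega)
      ⟨by omega, fun k hk hk' => ?_⟩
    rcases eq_or_lt_of_le hk' with rfl | hk'
    · exact hl
    · exact hb2 k hk (by omega)

theorem NoBacktracking.mem_component (hp : NoBacktracking p) {a b t : ℕ}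
    (h : IsComponent p l a b) (ht : LetterIsH p l t) (hat : (p.vertex a)⁻¹ * p.vertex t ∈ H l) :
    a ≤ t ∧ t ≤ b := by
  obtain ⟨α, β, hc, h1, h2⟩ := ht.exists_isComponent
  have h3 := hc.mem h1 (by omega : t ≤ β + 1)
  obtain ⟨rfl, rfl⟩ := hp l a b α β h hc (by
    have := (H l).mul_mem hat ((H l).inv_mem h3)
    simpa [ConnectedComp, mul_assoc] using this)
  exact ⟨h1, h2⟩

theorem isPhase_zero : IsPhase p 0 := by
  rintro ⟨l, a, b, -, h, -⟩
  omega

theorem IsComponent.isPhase_left {a b : ℕ} (h : IsComponent p l a b) : IsPhase p a := by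
  rintro ⟨l', α, β, hc, h1, h2⟩
  obtain rfl := (h.2.2.1 a le_rfl h.1).index_unique (hc.2.2.1 a h1.le h2)
  rcases h.2.2.2.1 with h0 | h0
  · omega
  · exact h0 (hc.2.2.1 _ (by omega) (by omega))

theorem IsComponent.isPhase_right {a b : ℕ} (h : IsComponent p l a b) : IsPhase p (b + 1) := by
  rintro ⟨l', α, β, hc, h1, h2⟩
  obtain rfl := (h.2.2.1 b h.1 le_rfl).index_unique (hc.2.2.1 b (by omega) (by omega))
  rcases h.2.2.2.2 with h0 | h0
  · have := hc.2.1
    omega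
  · exact h0 (hc.2.2.1 _ (by omega) (by omega))

theorem Route.of_path {g : G} {φ : G → ℝ} {a b : ℕ} (hab : a ≤ b) (hb : b ≤ p.len)
    (h : ∀ t, a ≤ t → t < b → LetterIsH p l t → g⁻¹ * p.vertex t ∉ H l) :
    Route H X (cosetFn H l g φ) (p.vertex a) (p.vertex b) (b - a) 0 := by
  induction b, hab using Nat.le_induction with
  | base => simpa using Route.refl _
  | succ b hab ih =>
    have h1 := ih (by omega) fun t ht ht' => h t ht (by omega)
    obtain ⟨e, he, hv⟩ := p.exists_letter (show b < p.len by omega)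
    have h2 := Route.of_letter (P := cosetFn H l g φ) (p.vertex b) e
    rw [Route.letterWeight_eq_zero fun hl => h b hab (by omega) ⟨e, he, hl⟩, ← hv] at h2
    exact (h1.trans_zero h2).mono (by omega)

/-- The combinatorial metric of the Cayley graph with real values. -/
noncomputable abbrev rdist (H : Λ → Subgroup G) (X : Set G) (x y : G) : ℝ := (relDist H X x y : ℝ)

theorem rdist_comm (hX : Subgroup.closure X = ⊤) (x y : G) : rdist H X x y = rdist H X y x := by
  rw [rdist, relDist_comm hX]

theorem rdist_triangle (hX : Subgroup.closure X = ⊤) (x y z : G) :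
    rdist H X x z ≤ rdist H X x y + rdist H X y z := by
  exact_mod_cast relDist_triangle hX x y z

theorem rdist_vertex_succ_le {t : ℕ} (ht : t < p.len) :
    rdist H X (p.vertex t) (p.vertex (t + 1)) ≤ 1 := by
  obtain ⟨a, -, hv⟩ := p.exists_letter ht
  rw [hv]
  exact_mod_cast relDist_mul_val_le _ a

theorem IsQuasiGeodesic.seq_forward {lam c : ℝ} (hp : IsQuasiGeodesic lam c p) {i n : ℕ}
    (hn : i + n ≤ p.len) :
    IsQuasiGeodesicSeq (rdist H X) lam c (fun t => p.vertex (i + t)) n :=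
  ⟨fun t ht => rdist_vertex_succ_le (by omega), fun a b hab hb => by
    have := hp (i + a) (i + b) (by omega) (by omega)
    rwa [show i + b - (i + a) = b - a by omega, Nat.cast_sub hab] at this⟩

theorem IsQuasiGeodesic.seq_backward (hX : Subgroup.closure X = ⊤) {lam c : ℝ}
    (hp : IsQuasiGeodesic lam c p) {i n : ℕ} (hi : i ≤ p.len) (hn : n ≤ i) :
    IsQuasiGeodesicSeq (rdist H X) lam c (fun t => p.vertex (i - t)) n :=
  ⟨fun t ht => by
    have := rdist_vertex_succ_le (p := p) (t := i - (t + 1)) (by omega)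
    rw [show i - (t + 1) + 1 = i - t by omega] at this
    rwa [rdist_comm hX], fun a b hab hb => by
    have := hp (i - b) (i - a) (by omega) (by omega)
    rw [show i - a - (i - b) = b - a by omega, Nat.cast_sub hab, relDist_comm hX] at this
    exact this⟩

end Paths

section CosetPenetration

variable {G : Type*} [Group G] {Λ : Type*} {H : Λ → Subgroup G} {X : Set G}

theorem exists_relDist_stability (hXfin : X.Finite) (hXgen : Subgroup.closure X = ⊤)
    (hhyp : IsRelHyperbolic H) {lam c κ : ℝ} (hlam : 1 ≤ lam) (hc : 0 ≤ c) (hκ : 0 ≤ κ) :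
    ∃ D : ℝ, 0 ≤ D ∧ ∀ (x y : ℕ → G) (n m : ℕ), IsQuasiGeodesicSeq (rdist H X) lam c x n →
      IsQuasiGeodesicSeq (rdist H X) lam c y m → rdist H X (x 0) (y 0) ≤ κ →
      rdist H X (x n) (y m) ≤ κ → ∀ i ≤ n, ∃ j ≤ m, rdist H X (x i) (y j) ≤ D := by
  obtain ⟨K, hK, hmain⟩ := exists_closed_path_bound hXfin hXgen hhyp
  refine exists_quasiGeodesic_stability (fun x => by simp [relDist_self])
    (fun x y => Nat.cast_nonneg _) (rdist_comm hXgen) (rdist_triangle hXgen) ?_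
    (fun f g hf hg z n hz => hmain f g hf hg z n fun i hi => by exact_mod_cast hz i hi)
    hK hlam hc hκ
  intro x y
  obtain ⟨w, hw, rfl⟩ := exists_relWord (H := H) hXgen x y
  let r : RelPath H X := ⟨x, w⟩
  refine ⟨w.length, r.vertex, by exact_mod_cast hw.le, r.vertex_zero, ?_,
    fun i hi => rdist_vertex_succ_le hi⟩
  simp [r, RelPath.vertex, wval]

theorem rdist_le_one_of_mem {l : Λ} {g x y : G} (hx : g⁻¹ * x ∈ H l) (hy : g⁻¹ * y ∈ H l) :
    rdist H X x y ≤ 1 := by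
  have := (H l).mul_mem ((H l).inv_mem hx) hy
  exact_mod_cast relDist_le_one_of_mem (X := X) (l := l) (by simpa [mul_assoc] using this)

/-- Two quasi-geodesics with the same endpoints up to a bounded error can be joined, at bounded
distance from their initial points, by a short path which stays away from the initial points or
uses only letters of `X`. -/
theorem exists_anchor (hXfin : X.Finite) (hXgen : Subgroup.closure X = ⊤)
    (hhyp : IsRelHyperbolic H) {lam c κ k : ℝ} (N : ℝ) (hlam : 1 ≤ lam) (hc : 0 ≤ c) (hκ : 0 ≤ κ)
    (hk : 0 ≤ k) :
    ∃ B : ℕ, ∀ (x y : ℕ → G) (n m : ℕ), IsQuasiGeodesicSeq (rdist H X) lam c x n →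
      IsQuasiGeodesicSeq (rdist H X) lam c y m → rdist H X (x 0) (y 0) ≤ κ →
      (xDist X (x n) (y m) : ℝ) ≤ k →
      ∃ t ≤ n, ∃ r ≤ m, t ≤ B ∧ r ≤ B ∧ (t = n ∨ N ≤ rdist H X (x t) (x 0)) ∧
        ∀ (l : Λ) (g : G) (φ : G → ℝ), (∀ z, g⁻¹ * z ∈ H l → rdist H X z (x 0) < N) →
          Route H X (cosetFn H l g φ) (x t) (y r) B 0 := by
  obtain ⟨D, hD, hmorse⟩ := exists_relDist_stability hXfin hXgen hhyp hlam hc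
    (le_max_of_le_left hκ : 0 ≤ max κ k)
  have hlam0 : 0 < lam := by linarith
  set T := ⌈lam * (N + D) + c⌉₊ with hT
  set B := ⌈lam * (κ + T + D + k) + c⌉₊ + T + ⌈D⌉₊ + ⌈k⌉₊ with hB
  refine ⟨B, fun x y n m hx hy h0 h1 => ?_⟩
  have hself : ∀ z, rdist H X z z = 0 := fun z => by simp [relDist_self]
  have hx0 : ∀ t ≤ n, rdist H X (x 0) (x t) ≤ t := fun t ht =>
    dist_le_of_steps hself (rdist_triangle hXgen) fun i hi => hx.step i (by omega)
  have hlen : ∀ t ≤ n, t ≤ T → ∀ r ≤ m, rdist H X (x t) (y r) ≤ D + k → r ≤ B := by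
    intro t ht htT r hr hd
    have a1 := hy.bound 0 r (Nat.zero_le _) hr
    have a2 := rdist_triangle (H := H) hXgen (y 0) (x 0) (y r)
    have a3 := rdist_triangle (H := H) hXgen (x 0) (x t) (y r)
    have a4 := hx0 t ht
    have a5 : (t : ℝ) ≤ T := by exact_mod_cast htT
    rw [rdist_comm hXgen (y 0) (x 0)] at a2
    have a6 : rdist H X (y 0) (y r) ≤ κ + T + D + k := by linarith
    have a7 : lam * rdist H X (y 0) (y r) ≤ lam * (κ + T + D + k) := by gcongr
    have a8 : (r : ℝ) ≤ lam * (κ + T + D + k) + c := by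
      push_cast at a1
      linarith
    have a9 : r ≤ ⌈lam * (κ + T + D + k) + c⌉₊ := by
      exact_mod_cast a8.trans (Nat.le_ceil _)
    omega
  rcases le_or_gt n T with hnT | hnT
  · have hk' : xDist X (x n) (y m) ≤ ⌈k⌉₊ := by exact_mod_cast h1.trans (Nat.le_ceil _)
    have hk'' : rdist H X (x n) (y m) ≤ D + k := by
      have : rdist H X (x n) (y m) ≤ xDist X (x n) (y m) := by
        exact_mod_cast relDist_le_xDist hXgen _ _
      linarith
    refine ⟨n, le_rfl, m, le_rfl, by omega, hlen n le_rfl hnT m le_rfl hk'', Or.inl rfl,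
      fun l g φ _ => ?_⟩
    obtain ⟨w, hw, hwy, hwX⟩ := exists_xWord (H := H) hXgen (x n) (y m)
    rw [← hwy]
    refine (Route.of_word fun u a v huv ha => ?_).mono (by omega)
    rw [hwX a (by simp [huv])] at ha
    cases ha
  · obtain ⟨r, hr, hd⟩ := hmorse x y n m hx hy (h0.trans (le_max_left _ _)) (by
      refine le_trans ?_ (h1.trans (le_max_right _ _))
      exact_mod_cast relDist_le_xDist hXgen _ _) T hnT.le
    have hfar : N + D ≤ rdist H X (x T) (x 0) := by
      have a1 := hx.bound 0 T (Nat.zero_le _) hnT.le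
      have a2 : lam * (N + D) + c ≤ T := Nat.le_ceil _
      rw [rdist_comm hXgen]
      refine le_of_mul_le_mul_left ?_ hlam0
      push_cast at a1
      linarith
    refine ⟨T, hnT.le, r, hr, by omega, hlen T hnT.le le_rfl r hr (by linarith),
      Or.inr (by linarith), fun l g φ hg => ?_⟩
    obtain ⟨w, hw, hwy⟩ := exists_relWord (H := H) hXgen (x T) (y r)
    have hwD : (w.length : ℝ) ≤ D := by
      rw [hw]; exact hd
    have hwD' : w.length ≤ ⌈D⌉₊ := by exact_mod_cast hwD.trans (Nat.le_ceil _)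
    rw [← hwy]
    refine (Route.of_word fun u a v huv _ hmem => ?_).mono (by omega)
    have a1 := hg _ hmem
    have a2 := rdist_triangle (H := H) hXgen (x T) (x T * wval u) (x 0)
    have a3 : rdist H X (x T) (x T * wval u) ≤ u.length := by
      exact_mod_cast relDist_mul_wval_le _ _
    have a4 : (u.length : ℝ) ≤ w.length := by
      exact_mod_cast (by rw [huv]; simp : u.length ≤ w.length)
    linarith

/-- A closed route has a value bounded linearly in its length. -/
theorem exists_route_bound (hXfin : X.Finite) (hhyp : IsRelHyperbolic H) :
    ∃ K : ℝ, 0 ≤ K ∧ ∀ (l : Λ) (g : G) (φ : G → ℝ), (∀ x y, |φ x - φ y| ≤ xDist X x y) →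
      ∀ (x : G) (n : ℕ) (S : ℝ), Route H X (cosetFn H l g φ) x x n S → |S| ≤ K * (n + 1) := by
  obtain ⟨K, hK, hmain⟩ := exists_component_bound (H := H) hXfin hhyp
  refine ⟨K, hK, ?_⟩
  rintro l g φ hφ x n S ⟨w, hw, hwx, rfl⟩
  refine (hmain l g φ hφ w x (by simpa using hwx)).trans ?_
  gcongr

theorem abs_xDist_sub_le (hXgen : Subgroup.closure X = ⊤) (g x y : G) :
    |(xDist X g x : ℝ) - xDist X g y| ≤ xDist X x y := by
  have h1 : (xDist X g x : ℝ) ≤ xDist X g y + xDist X y x := by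
    exact_mod_cast xDist_triangle hXgen g y x
  have h2 : (xDist X g y : ℝ) ≤ xDist X g x + xDist X x y := by
    exact_mod_cast xDist_triangle hXgen g x y
  rw [xDist_comm hXgen y x] at h1
  rw [abs_le]
  constructor <;> linarith

/-- The distance between two points of a coset is bounded in terms of the length of a route
between them that avoids the coset. -/
theorem xDist_le_of_route (hXgen : Subgroup.closure X = ⊤) {K : ℝ}
    (hK : ∀ (l : Λ) (g : G) (φ : G → ℝ), (∀ x y, |φ x - φ y| ≤ xDist X x y) →
      ∀ (x : G) (n : ℕ) (S : ℝ), Route H X (cosetFn H l g φ) x x n S → |S| ≤ K * (n + 1))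
    {l : Λ} {x y : G} (hxy : x⁻¹ * y ∈ H l) {n : ℕ} {S : ℝ}
    (h : Route H X (cosetFn H l x fun z => (xDist X x z : ℝ)) x y n S) :
    (xDist X x y : ℝ) ≤ K * (n + 2) + |S| := by
  have h1 := Route.of_mem (X := X) (φ := fun z => (xDist X x z : ℝ)) (g := x)
    (by simp : x⁻¹ * x ∈ H l) hxy
  have h2 := hK l x _ (abs_xDist_sub_le hXgen x) x _ _ (h1.trans h.symm)
  simp only [xDist_self, Nat.cast_zero, sub_zero] at h2
  have h3 := le_abs_self ((xDist X x y : ℝ) + -S)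
  have h4 := le_abs_self S
  push_cast at h2
  have h5 : K * (1 + (n : ℝ) + 1) = K * (n + 2) := by ring
  linarith

/-- Connected components of quasi-geodesics without backtracking have close endpoints. -/
theorem exists_connected_bound (hXfin : X.Finite) (hXgen : Subgroup.closure X = ⊤)
    (hhyp : IsRelHyperbolic H) {lam c k : ℝ} (hlam : 1 ≤ lam) (hc : 0 ≤ c) (hk : 0 ≤ k) :
    ∃ ε : ℝ, 0 ≤ ε ∧ ∀ p q : RelPath H X, IsQuasiGeodesic lam c p → IsQuasiGeodesic lam c q →
      Similar k p q → NoBacktracking p → NoBacktracking q →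
      ∀ (l : Λ) (a b a' b' : ℕ), IsComponent p l a b → IsComponent q l a' b' →
        ConnectedComp p q l a a' →
        (xDist X (p.vertex a) (q.vertex a') : ℝ) ≤ ε ∧
        (xDist X (p.vertex (b + 1)) (q.vertex (b' + 1)) : ℝ) ≤ ε := by
  obtain ⟨K, hK, hroute⟩ := exists_route_bound (H := H) hXfin hhyp
  obtain ⟨B, hB⟩ := exists_anchor (H := H) hXfin hXgen hhyp 2 hlam hc zero_le_one hk
  refine ⟨K * ((B + B + B : ℕ) + 2), by positivity, ?_⟩
  intro p q hp hq hpq hpb hqb l a b a' b' hs ht hst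
  have hclose : ∀ x z, x⁻¹ * z ∈ H l → rdist H X z x < 2 := fun x z h => by
    have := rdist_le_one_of_mem (X := X) h (by simp : x⁻¹ * x ∈ H l)
    linarith
  have hpmem := hs.mem (hs.1.trans (Nat.le_succ b)) le_rfl
  have hqmem := ht.mem (ht.1.trans (Nat.le_succ b')) le_rfl
  have hst' : (p.vertex a)⁻¹ * q.vertex a' ∈ H l := hst
  have hright : (p.vertex (b + 1))⁻¹ * q.vertex (b' + 1) ∈ H l := by
    have := (H l).mul_mem ((H l).inv_mem hpmem) ((H l).mul_mem hst' hqmem)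
    simpa [mul_assoc] using this
  have hqleft : (q.vertex a')⁻¹ * p.vertex a ∈ H l := by
    simpa using (H l).inv_mem hst'
  have hmemq : ∀ t, (p.vertex a)⁻¹ * q.vertex t ∈ H l → (q.vertex a')⁻¹ * q.vertex t ∈ H l :=
    fun t h => by simpa [mul_assoc] using (H l).mul_mem hqleft h
  have hright' : ∀ z, (p.vertex (b + 1))⁻¹ * z ∈ H l → (p.vertex a)⁻¹ * z ∈ H l :=
    fun z h => by simpa [mul_assoc] using (H l).mul_mem hpmem h
  have hs1 := hs.1
  have hs2 := hs.2.1
  have ht1 := ht.1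
  have ht2 := ht.2.1
  constructor
  · obtain ⟨t, hta, r, hra, htB, hrB, -, hroute'⟩ := hB (fun t => p.vertex (a - t))
      (fun t => q.vertex (a' - t)) a a'
      (hp.seq_backward hXgen (by omega) le_rfl) (hq.seq_backward hXgen (by omega) le_rfl)
      (by exact_mod_cast relDist_le_one_of_mem hst')
      (by simpa [RelPath.vertex_zero] using hpq.1)
    have h1 := hroute' l (p.vertex a) (fun z => (xDist X (p.vertex a) z : ℝ))
      (hclose (p.vertex a))
    have h2 := Route.of_path (p := p) (g := p.vertex a)
      (φ := fun z => (xDist X (p.vertex a) z : ℝ)) (l := l) (a := a - t) (b := a)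
      (by omega) (by omega) fun s hs1 hs2 hs3 hs4 => by
        have := hpb.mem_component hs hs3 hs4
        omega
    have h3 := Route.of_path (p := q) (g := p.vertex a)
      (φ := fun z => (xDist X (p.vertex a) z : ℝ)) (l := l) (a := a' - r) (b := a')
      (by omega) (by omega) fun s hs1 hs2 hs3 hs4 => by
        have := hqb.mem_component ht hs3 (hmemq _ hs4)
        omega
    have h4 := xDist_le_of_route hXgen hroute hst'
      (((h2.symm_zero.trans_zero h1).trans_zero h3).mono (m := B + B + B) (by omega))
    simpa using h4
  · obtain ⟨t, hta, r, hra, htB, hrB, -, hroute'⟩ := hB (fun t => p.vertex (b + 1 + t))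
      (fun t => q.vertex (b' + 1 + t)) (p.len - (b + 1)) (q.len - (b' + 1))
      (hp.seq_forward (by omega)) (hq.seq_forward (by omega))
      (by exact_mod_cast relDist_le_one_of_mem hright)
      (by
        rw [show b + 1 + (p.len - (b + 1)) = p.len by omega,
          show b' + 1 + (q.len - (b' + 1)) = q.len by omega]
        exact hpq.2)
    have h1 := hroute' l (p.vertex (b + 1)) (fun z => (xDist X (p.vertex (b + 1)) z : ℝ))
      (hclose (p.vertex (b + 1)))
    have h2 := Route.of_path (p := p) (g := p.vertex (b + 1))
      (φ := fun z => (xDist X (p.vertex (b + 1)) z : ℝ)) (l := l) (a := b + 1) (b := b + 1 + t)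
      (by omega) (by omega) fun s hs1 hs2 hs3 hs4 => by
        have := hpb.mem_component hs hs3 (hright' _ hs4)
        omega
    have h3 := Route.of_path (p := q) (g := p.vertex (b + 1))
      (φ := fun z => (xDist X (p.vertex (b + 1)) z : ℝ)) (l := l) (a := b' + 1) (b := b' + 1 + r)
      (by omega) (by omega) fun s hs1 hs2 hs3 hs4 => by
        have := hqb.mem_component ht hs3 (hmemq _ (hright' _ hs4))
        omega
    have h4 := xDist_le_of_route hXgen hroute hright
      (((h2.trans_zero h1).trans_zero h3.symm_zero).mono (m := B + B + B) (by omega))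
    simpa using h4

theorem Similar.symm (hXgen : Subgroup.closure X = ⊤) {k : ℝ} {p q : RelPath H X}
    (h : Similar k p q) : Similar k q p :=
  ⟨xDist_comm hXgen p.start q.start ▸ h.1, xDist_comm hXgen p.finish q.finish ▸ h.2⟩

theorem exists_vertex_close (hXfin : X.Finite) (hXgen : Subgroup.closure X = ⊤)
    (hhyp : IsRelHyperbolic H) {lam c k : ℝ} (hlam : 1 ≤ lam) (hc : 0 ≤ c) (hk : 0 ≤ k) :
    ∃ D : ℝ, 0 ≤ D ∧ ∀ p q : RelPath H X, IsQuasiGeodesic lam c p → IsQuasiGeodesic lam c q →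
      Similar k p q → ∀ i ≤ p.len, ∃ j ≤ q.len, rdist H X (p.vertex i) (q.vertex j) ≤ D := by
  obtain ⟨D, hD, hmain⟩ := exists_relDist_stability hXfin hXgen hhyp hlam hc hk
  refine ⟨D, hD, fun p q hp hq hpq i hi => ?_⟩
  have hle : ∀ x y : G, rdist H X x y ≤ xDist X x y := fun x y => by
    exact_mod_cast relDist_le_xDist hXgen x y
  have := hmain _ _ p.len q.len (hp.seq_forward (i := 0) (by omega))
    (hq.seq_forward (i := 0) (by omega))
    ((hle _ _).trans (by simpa [RelPath.vertex_zero] using hpq.1))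
    ((hle _ _).trans (by simp only [zero_add]; exact hpq.2)) i hi
  simpa using this

/-- Components which are not connected to a component of the other path are short. -/
theorem exists_isolated_bound (hXfin : X.Finite) (hXgen : Subgroup.closure X = ⊤)
    (hhyp : IsRelHyperbolic H) {lam c k : ℝ} (hlam : 1 ≤ lam) (hc : 0 ≤ c) (hk : 0 ≤ k) :
    ∃ ε : ℝ, 0 ≤ ε ∧ ∀ p q : RelPath H X, IsQuasiGeodesic lam c p → IsQuasiGeodesic lam c q →
      Similar k p q → NoBacktracking p →
      ∀ (l : Λ) (a b : ℕ), IsComponent p l a b →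
        ε < (xDist X (p.vertex a) (p.vertex (b + 1)) : ℝ) →
        ∃ a' b', IsComponent q l a' b' ∧ ConnectedComp p q l a a' := by
  obtain ⟨K, hK, hroute⟩ := exists_route_bound (H := H) hXfin hhyp
  obtain ⟨D, hD, hclose⟩ := exists_vertex_close (H := H) hXfin hXgen hhyp hlam hc hk
  obtain ⟨B, hB⟩ := exists_anchor (H := H) hXfin hXgen hhyp 2 hlam hc
    (by positivity : 0 ≤ D + 1) hk
  refine ⟨K * ((6 * B : ℕ) + 2), by positivity, ?_⟩
  intro p q hp hq hpq hpb l a b hs hlong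
  by_contra! hiso
  refine hlong.not_ge ?_
  have hs1 := hs.1
  have hs2 := hs.2.1
  obtain ⟨j, hj, hd⟩ := hclose p q hp hq hpq a (by omega)
  have hpmem := hs.mem (hs.1.trans (Nat.le_succ b)) le_rfl
  have hmem0 : (p.vertex a)⁻¹ * p.vertex a ∈ H l := by simp
  set φ : G → ℝ := fun z => (xDist X (p.vertex a) z : ℝ)
  have havoid : ∀ t, LetterIsH q l t → (p.vertex a)⁻¹ * q.vertex t ∉ H l := by
    intro t ht hmem
    obtain ⟨α, β, hc, h1, h2⟩ := ht.exists_isComponent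
    refine hiso α β hc ?_
    have := (H l).mul_mem hmem ((H l).inv_mem (hc.mem h1 (by omega)))
    simpa [ConnectedComp, mul_assoc] using this
  obtain ⟨t, hta, r, hra, htB, hrB, -, h1⟩ := hB (fun t => p.vertex (a - t))
    (fun t => q.vertex (j - t)) a j
    (hp.seq_backward hXgen (by omega) le_rfl) (hq.seq_backward hXgen hj le_rfl)
    (hd.trans (by linarith)) (by simpa [RelPath.vertex_zero] using hpq.1)
  obtain ⟨t', hta', r', hra', htB', hrB', -, h2⟩ := hB (fun t => p.vertex (b + 1 + t))
    (fun t => q.vertex (j + t)) (p.len - (b + 1)) (q.len - j)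
    (hp.seq_forward (by omega)) (hq.seq_forward (by omega))
    (by
      have a1 := rdist_triangle (H := H) hXgen (p.vertex (b + 1)) (p.vertex a) (q.vertex j)
      have a2 := rdist_le_one_of_mem (X := X) hpmem hmem0
      simp only [add_zero]
      linarith)
    (by
      rw [show b + 1 + (p.len - (b + 1)) = p.len by omega,
        show j + (q.len - j) = q.len by omega]
      exact hpq.2)
  have e1 := h1 l (p.vertex a) φ fun z hz => (rdist_le_one_of_mem hz hmem0).trans_lt one_lt_two
  have e2 := h2 l (p.vertex a) φ fun z hz => (rdist_le_one_of_mem hz hpmem).trans_lt one_lt_two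
  have e3 := Route.of_path (p := p) (g := p.vertex a) (φ := φ) (l := l) (a := a - t) (b := a)
    (by omega) (by omega) fun s hs1 hs2 hs3 hs4 => by
      have := hpb.mem_component hs hs3 hs4
      omega
  have e4 := Route.of_path (p := p) (g := p.vertex a) (φ := φ) (l := l) (a := b + 1)
    (b := b + 1 + t') (by omega) (by omega) fun s hs1 hs2 hs3 hs4 => by
      have := hpb.mem_component hs hs3 hs4
      omega
  have e5 := Route.of_path (p := q) (g := p.vertex a) (φ := φ) (l := l) (a := j - r)
    (b := j + r') (by omega) (by omega) fun s _ _ hs3 => havoid s hs3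
  have e6 := xDist_le_of_route hXgen hroute hpmem
    (((((e3.symm_zero.trans_zero e1).trans_zero e5).trans_zero e2.symm_zero).trans_zero
      e4.symm_zero).mono (m := 6 * B) (by omega))
  simpa using e6

end CosetPenetration

section PhaseVertices

variable {G : Type*} [Group G] {Λ : Type*} {H : Λ → Subgroup G} {X : Set G} {p q : RelPath H X}
  {l : Λ}

theorem xDist_mul_wval_le (hXgen : Subgroup.closure X = ⊤) {M : ℝ} {x : G}
    {w : List (RelLetter H X)}
    (h : ∀ u a v, w = u ++ a :: v → (xDist X (x * wval u) (x * wval u * a.val) : ℝ) ≤ M) :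
    (xDist X x (x * wval w) : ℝ) ≤ w.length * M := by
  induction w generalizing x with
  | nil => simp [xDist_self]
  | cons a w ih =>
    have h1 := ih (x := x * a.val) fun u b v huv => by
      have := h (a :: u) b v (by simp [huv])
      rwa [wval_cons, ← mul_assoc x] at this
    have h2 := h [] a w rfl
    have h3 : (xDist X x (x * wval (a :: w)) : ℝ) ≤
        xDist X x (x * a.val) + xDist X (x * a.val) (x * wval (a :: w)) := by
      exact_mod_cast xDist_triangle hXgen _ _ _
    rw [wval_cons, ← mul_assoc] at h3 ⊢
    rw [wval_nil, mul_one] at h2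
    rw [List.length_cons]
    push_cast
    linarith

/-- A geodesic word has no two letters lying in the same coset. -/
theorem not_mem_of_geodesic (hXgen : Subgroup.closure X = ⊤) {x : G} {u v w : List (RelLetter H X)}
    {a b : RelLetter H X}
    (h : (u ++ a :: (v ++ b :: w)).length ≤
      relDist H X x (x * wval (u ++ a :: (v ++ b :: w))))
    (hb : b.hIndex = some l) : a.val * wval v ∉ H l := by
  intro hmem
  have h1 : relDist H X (x * wval u) (x * wval u * (a.val * wval v * b.val)) ≤ 1 :=
    relDist_le_one_of_mem (l := l) (by
      rw [inv_mul_cancel_left]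
      exact (H l).mul_mem hmem (val_mem_of_hIndex hb))
  have h2 := relDist_mul_wval_le (H := H) (X := X) x u
  have h3 := relDist_mul_wval_le (x * wval u * (a.val * wval v * b.val)) w
  have h4 := relDist_triangle (H := H) hXgen x (x * wval u)
    (x * wval (u ++ a :: (v ++ b :: w)))
  have h5 := relDist_triangle (H := H) hXgen (x * wval u)
    (x * wval u * (a.val * wval v * b.val)) (x * wval (u ++ a :: (v ++ b :: w)))
  have h6 : x * wval (u ++ a :: (v ++ b :: w)) =
      x * wval u * (a.val * wval v * b.val) * wval w := by simp [mul_assoc]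
  rw [h6] at h4 h5 h
  simp only [List.length_append, List.length_cons] at h
  omega

theorem IsPhase.component_le {i t a b : ℕ} (hi : IsPhase p i) (h : IsComponent p l a b)
    (hat : a ≤ t) (hti : t < i) : b + 1 ≤ i := by
  by_contra hlt
  exact hi ⟨l, a, b, h, by omega, by omega⟩

/-- The last component of `p` before the index `i` connected to a component of `q`. -/
theorem exists_last_connected (p q : RelPath H X) (i : ℕ) :
    ∃ i₁ ≤ i, ∃ j₁ ≤ q.len, IsPhase p i₁ ∧ IsPhase q j₁ ∧
      ((i₁ = 0 ∧ j₁ = 0) ∨ ∃ l a b a' b', IsComponent p l a b ∧ IsComponent q l a' b' ∧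
        ConnectedComp p q l a a' ∧ i₁ = b + 1 ∧ j₁ = b' + 1) ∧
      ∀ l a b a' b', IsComponent p l a b → IsComponent q l a' b' →
        ConnectedComp p q l a a' → b + 1 ≤ i → b + 1 ≤ i₁ := by
  classical
  let P : ℕ → Prop := fun i₁ => i₁ = 0 ∨ ∃ l a b a' b', IsComponent p l a b ∧
    IsComponent q l a' b' ∧ ConnectedComp p q l a a' ∧ i₁ = b + 1
  have hspec : P (Nat.findGreatest P i) := Nat.findGreatest_spec (Nat.zero_le i) (Or.inl rfl)
  have hlast : ∀ l a b a' b', IsComponent p l a b → IsComponent q l a' b' →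
      ConnectedComp p q l a a' → b + 1 ≤ i → b + 1 ≤ Nat.findGreatest P i :=
    fun l a b a' b' h1 h2 h3 h4 =>
      Nat.le_findGreatest h4 (Or.inr ⟨l, a, b, a', b', h1, h2, h3, rfl⟩)
  refine ⟨Nat.findGreatest P i, Nat.findGreatest_le i, ?_⟩
  rcases hspec with h0 | ⟨l, a, b, a', b', h1, h2, h3, h4⟩
  · refine ⟨0, Nat.zero_le _, ?_, isPhase_zero, Or.inl ⟨h0, rfl⟩, hlast⟩
    rw [h0]
    exact isPhase_zero
  · refine ⟨b' + 1, h2.2.1, ?_, h2.isPhase_right,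
      Or.inr ⟨l, a, b, a', b', h1, h2, h3, h4, rfl⟩, hlast⟩
    rw [h4]
    exact h1.isPhase_right

/-- A point is met by `q` if it is a phase vertex of `q` or lies in the coset of a component
of `q`. -/
def IsMet (q : RelPath H X) (z : G) : Prop :=
  (∃ j ≤ q.len, IsPhase q j ∧ z = q.vertex j) ∨
    ∃ l a b, IsComponent q l a b ∧ (q.vertex a)⁻¹ * z ∈ H l

theorem isMet_vertex {j : ℕ} (hj : j ≤ q.len) : IsMet q (q.vertex j) := by
  by_cases h : IsPhase q j
  · exact Or.inl ⟨j, hj, h, rfl⟩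
  · obtain ⟨l, a, b, hc, h1, h2⟩ := not_not.1 h
    exact Or.inr ⟨l, a, b, hc, hc.mem h1.le (by omega)⟩

theorem exists_nearest_isMet (q : RelPath H X) (u : G) :
    ∃ z, IsMet q z ∧ ∀ z', IsMet q z' → relDist H X u z ≤ relDist H X u z' := by
  classical
  have hex : ∃ n z, IsMet q z ∧ relDist H X u z = n := ⟨_, _, isMet_vertex (Nat.zero_le _), rfl⟩
  obtain ⟨z, hz, hzn⟩ := Nat.find_spec hex
  exact ⟨z, hz, fun z' hz' => hzn ▸ Nat.find_min' hex ⟨z', hz', rfl⟩⟩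

/-- Phase vertices of one quasi-geodesic are close to phase vertices of the other. -/
theorem exists_phase_bound (hXfin : X.Finite) (hXgen : Subgroup.closure X = ⊤)
    (hhyp : IsRelHyperbolic H) {lam c k : ℝ} (hlam : 1 ≤ lam) (hc : 0 ≤ c) (hk : 0 ≤ k) :
    ∃ ε : ℝ, 0 ≤ ε ∧ ∀ p q : RelPath H X, IsQuasiGeodesic lam c p → IsQuasiGeodesic lam c q →
      Similar k p q → NoBacktracking p → NoBacktracking q → ∀ i ≤ p.len, IsPhase p i →
        ∃ j ≤ q.len, IsPhase q j ∧ (xDist X (p.vertex i) (q.vertex j) : ℝ) ≤ ε := by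
  obtain ⟨K, hK, hroute⟩ := exists_route_bound (H := H) hXfin hhyp
  obtain ⟨D, hD, hclose⟩ := exists_vertex_close (H := H) hXfin hXgen hhyp hlam hc hk
  obtain ⟨ε₂, hε₂, hisol⟩ := exists_isolated_bound (H := H) hXfin hXgen hhyp hlam hc hk
  obtain ⟨ε₃, hε₃, hconn⟩ := exists_connected_bound (H := H) hXfin hXgen hhyp hlam hc hk
  obtain ⟨B, hB⟩ := exists_anchor (H := H) hXfin hXgen hhyp (D + 3) hlam hc
    (by positivity : 0 ≤ D + 1) (le_max_of_le_left hk : 0 ≤ max k ε₃)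
  set M : ℝ := K * ((3 * B + 2 * ⌈D⌉₊ + 2 : ℕ) + 2) + ε₂ + 1 with hM
  have hM0 : 0 ≤ M := by positivity
  refine ⟨⌈D⌉₊ * M + M, by positivity, ?_⟩
  intro p q hp hq hpq hpb hqb i hi hphase
  obtain ⟨i₁, hi₁, j₁, hj₁, hi₁p, hj₁p, hbase, hlast⟩ := exists_last_connected p q i
  have hend : (xDist X (p.vertex i₁) (q.vertex j₁) : ℝ) ≤ max k ε₃ := by
    rcases hbase with ⟨rfl, rfl⟩ | ⟨l, a, b, a', b', h1, h2, h3, rfl, rfl⟩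
    · simpa [RelPath.vertex_zero] using Or.inl hpq.1
    · exact (hconn p q hp hq hpq hpb hqb l a b a' b' h1 h2 h3).2.trans (le_max_right _ _)
  set u := p.vertex i with hu
  obtain ⟨z, hz, hzmin⟩ := exists_nearest_isMet q u
  have hzD : rdist H X u z ≤ D := by
    obtain ⟨j, hj, hd⟩ := hclose p q hp hq hpq i hi
    refine le_trans ?_ hd
    exact_mod_cast hzmin _ (isMet_vertex hj)
  obtain ⟨j, hj, hjp, hzj⟩ : ∃ j ≤ q.len, IsPhase q j ∧ (z = q.vertex j ∨
      ∃ l a b, IsComponent q l a b ∧ (q.vertex a)⁻¹ * z ∈ H l ∧ z⁻¹ * q.vertex j ∈ H l ∧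
        ((j = a ∧ j₁ ≤ a) ∨ (j = b + 1 ∧ b + 1 ≤ j₁))) := by
    rcases hz with ⟨j, hj, hjp, rfl⟩ | ⟨l, a, b, hc, hmem⟩
    · exact ⟨j, hj, hjp, Or.inl rfl⟩
    · have hc1 := hc.1
      have hc2 := hc.2.1
      have hinv : ∀ x, (q.vertex a)⁻¹ * x ∈ H l → z⁻¹ * x ∈ H l := fun x hx => by
        simpa [mul_assoc] using (H l).mul_mem ((H l).inv_mem hmem) hx
      rcases le_or_gt j₁ a with h | h
      · exact ⟨a, by omega, hc.isPhase_left,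
          Or.inr ⟨l, a, b, hc, hmem, hinv _ (by simp), Or.inl ⟨rfl, h⟩⟩⟩
      · exact ⟨b + 1, by omega, hc.isPhase_right,
          Or.inr ⟨l, a, b, hc, hmem, hinv _ (hc.mem (by omega) le_rfl),
            Or.inr ⟨rfl, hj₁p.component_le hc le_rfl h⟩⟩⟩
  have hzjd : rdist H X z (q.vertex j) ≤ 1 := by
    rcases hzj with rfl | ⟨l, a, b, -, -, hm, -⟩
    · simp [relDist_self]
    · exact_mod_cast relDist_le_one_of_mem hm
  have hud : rdist H X u (q.vertex j) ≤ D + 1 := by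
    have := rdist_triangle (H := H) hXgen u z (q.vertex j)
    linarith
  obtain ⟨t, ht, htB, htfar, hret⟩ : ∃ t ≤ i - i₁, t ≤ B ∧
      (t = i - i₁ ∨ D + 3 ≤ rdist H X (p.vertex (i - t)) u) ∧
      ∀ (l : Λ) (g : G) (φ : G → ℝ), (∀ x, g⁻¹ * x ∈ H l → rdist H X x u < D + 3) →
        (∀ s, min j j₁ ≤ s → s < max j j₁ → LetterIsH q l s → g⁻¹ * q.vertex s ∉ H l) →
          Route H X (cosetFn H l g φ) (p.vertex (i - t)) (q.vertex j) (B + B) 0 := by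
    have hpseq := hp.seq_backward hXgen hi (Nat.sub_le i i₁)
    rcases le_total j₁ j with h | h
    · obtain ⟨t, ht, r, hr, htB, hrB, htfar, hanchor⟩ := hB _ _ (i - i₁) (j - j₁) hpseq
        (hq.seq_backward hXgen hj (Nat.sub_le j j₁)) hud (by
          rwa [show i - (i - i₁) = i₁ by omega, show j - (j - j₁) = j₁ by omega])
      refine ⟨t, ht, htB, htfar, fun l g φ hg hs => ?_⟩
      have h1 := hanchor l g φ hg
      have h2 := Route.of_path (p := q) (g := g) (φ := φ) (l := l) (a := j - r) (b := j)
        (by omega) hj fun s hs1 hs2 => hs s (by omega) (by omega)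
      exact (h1.trans_zero h2).mono (by omega)
    · obtain ⟨t, ht, r, hr, htB, hrB, htfar, hanchor⟩ := hB _ _ (i - i₁) (j₁ - j) hpseq
        (hq.seq_forward (i := j) (n := j₁ - j) (by omega)) hud (by
          rwa [show i - (i - i₁) = i₁ by omega, show j + (j₁ - j) = j₁ by omega])
      refine ⟨t, ht, htB, htfar, fun l g φ hg hs => ?_⟩
      have h1 := hanchor l g φ hg
      have h2 := Route.of_path (p := q) (g := g) (φ := φ) (l := l) (a := j) (b := j + r)
        (by omega) (by omega) fun s hs1 hs2 => hs s (by omega) (by omega)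
      exact (h1.trans_zero h2.symm_zero).mono (by omega)
  obtain ⟨o, ho, hoz⟩ := exists_relWord (H := H) hXgen u z
  have hoD : o.length ≤ ⌈D⌉₊ := by
    rw [ho]
    exact_mod_cast hzD.trans (Nat.le_ceil _)
  -- inner vertices of the geodesic from `u` to `z` are not met by `q`
  have hnotmet : ∀ v a w, o = v ++ a :: w → ¬ IsMet q (u * wval v) := by
    intro v a w hvw hmet
    have h1 := hzmin _ hmet
    have h2 := relDist_mul_wval_le (H := H) (X := X) u v
    rw [← ho, hvw] at h1
    simp only [List.length_append, List.length_cons] at h1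
    omega
  have hnear : ∀ (l : Λ) (x y : G), rdist H X u x ≤ D → x⁻¹ * y ∈ H l →
      rdist H X y u < D + 3 := by
    intro l x y hx hxy
    have h1 := rdist_triangle (H := H) hXgen u x y
    have h2 := rdist_le_one_of_mem (X := X) (by simp : x⁻¹ * x ∈ H l) hxy
    rw [rdist_comm hXgen]
    linarith
  have hzj_le : (xDist X z (q.vertex j) : ℝ) ≤ M := by
    rcases hzj with rfl | ⟨l, a, b, hc, haz, hm, hjab⟩
    · simpa [xDist_self] using hM0
    have h1 : Route H X (cosetFn H l z fun x => (xDist X z x : ℝ)) u z o.length 0 := by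
      rw [← hoz]
      refine Route.of_word fun v e w hvw _ hmem => hnotmet v e w hvw (Or.inr ⟨l, a, b, hc, ?_⟩)
      rw [hoz] at hmem
      simpa [mul_assoc] using (H l).mul_mem haz hmem
    have h2 : Route H X (cosetFn H l z fun x => (xDist X z x : ℝ)) (p.vertex (i - t)) u
        (i - (i - t)) 0 := by
      refine Route.of_path (by omega) hi fun s hs1 hs2 hs3 hs4 => ?_
      obtain ⟨α, β, hc', hαs, hsβ⟩ := hs3.exists_isComponent
      have h3 := hphase.component_le hc' hαs hs2
      have h4 := hlast l α β a b hc' hc (by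
        have h5 := hc'.mem hαs (by omega)
        have h6 := (H l).mul_mem h5 ((H l).inv_mem ((H l).mul_mem haz hs4))
        simpa [ConnectedComp, mul_assoc] using h6) h3
      omega
    have h3 := hret l z (fun x => (xDist X z x : ℝ)) (fun x hx => hnear l z x hzD hx)
      fun s hs1 hs2 hs3 hs4 => by
        have := hqb.mem_component hc hs3
          (by simpa [mul_assoc] using (H l).mul_mem haz hs4)
        omega
    have h4 := xDist_le_of_route hXgen hroute hm
      (((h1.symm_zero.trans_zero h2.symm_zero).trans_zero h3).mono
        (m := 3 * B + 2 * ⌈D⌉₊ + 2) (by omega))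
    rw [abs_zero] at h4
    linarith
  have hletter : ∀ v e w, o = v ++ e :: w →
      (xDist X (u * wval v) (u * wval v * e.val) : ℝ) ≤ M := by
    intro v e w hvw
    rcases hel : e.hIndex with _ | l
    · have h1 : (xDist X (u * wval v) (u * wval v * e.val) : ℝ) ≤ 1 := by
        exact_mod_cast xDist_mul_val_le_one _ hel
      have h2 : 0 ≤ K * (((3 * B + 2 * ⌈D⌉₊ + 2 : ℕ) : ℝ) + 2) := by positivity
      linarith
    set x := u * wval v with hx
    set φ : G → ℝ := fun y => (xDist X x y : ℝ)
    have hnot := hnotmet v e w hvw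
    have hgeo : (v ++ e :: w).length ≤ relDist H X u (u * wval (v ++ e :: w)) := by
      rw [← hvw, hoz, ho]
    have hxD : rdist H X u x ≤ D := by
      have h1 : rdist H X u x ≤ v.length := by
        exact_mod_cast relDist_mul_wval_le (H := H) (X := X) u v
      have h2 : (v.length : ℝ) ≤ rdist H X u z := by
        rw [rdist, ← ho, hvw]
        exact_mod_cast (by simp : v.length ≤ (v ++ e :: w).length)
      linarith
    have hxe : x⁻¹ * (x * e.val) ∈ H l := by simpa using val_mem_of_hIndex hel
    have havoid : ∀ s, LetterIsH q l s → x⁻¹ * q.vertex s ∉ H l := by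
      intro s hs hmem
      obtain ⟨α, β, hc, h1, h2⟩ := hs.exists_isComponent
      refine hnot (Or.inr ⟨l, α, β, hc, ?_⟩)
      have := (H l).mul_mem (hc.mem h1 (by omega)) ((H l).inv_mem hmem)
      simpa [mul_assoc] using this
    have h1 : Route H X (cosetFn H l x φ) u x v.length 0 := by
      refine Route.of_word fun v₁ a v₂ hv ha hmem => ?_
      subst hv
      refine not_mem_of_geodesic (l := l) hXgen (x := u) (u := v₁) (a := a) (v := v₂) (b := e)
        (w := w) (by simpa using hgeo) hel ?_
      have := (H l).inv_mem hmem
      rw [hx] at this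
      simpa [mul_assoc] using this
    have h2 : Route H X (cosetFn H l x φ) (x * e.val) z w.length 0 := by
      have hzw : z = x * e.val * wval w := by
        rw [← hoz, hvw, hx]
        simp [mul_assoc]
      rw [hzw]
      refine Route.of_word fun w₁ a w₂ hw ha hmem => ?_
      subst hw
      refine not_mem_of_geodesic (l := l) hXgen (x := u) (u := v) (a := e) (v := w₁) (b := a)
        (w := w₂) hgeo ha ?_
      simpa [mul_assoc] using hmem
    have h3 : Route H X (cosetFn H l x φ) z (q.vertex j) 1 0 := by
      rcases hzj with h0 | ⟨l', a, b, hc, haz, hm, -⟩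
      · rw [← h0]
        exact (Route.refl z).mono zero_le_one
      · refine Route.of_mem_of_avoid hm ?_
        rintro rfl hmem
        refine hnot (Or.inr ⟨l', a, b, hc, ?_⟩)
        have := (H l').mul_mem haz ((H l').inv_mem hmem)
        simpa [mul_assoc] using this
    have h4 := hret l x φ (fun y hy => hnear l x y hxD hy) fun s _ _ hs => havoid s hs
    obtain ⟨S, hS, h5⟩ : ∃ S : ℝ, |S| ≤ ε₂ ∧
        Route H X (cosetFn H l x φ) (p.vertex (i - t)) u (B + 1) S := by
      by_cases hex : ∃ s, i - t ≤ s ∧ s < i ∧ LetterIsH p l s ∧ x⁻¹ * p.vertex s ∈ H l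
      · obtain ⟨s, hs1, hs2, hs3, hs4⟩ := hex
        obtain ⟨α, β, hc, hαs, hsβ⟩ := hs3.exists_isComponent
        have hβi := hphase.component_le hc hαs hs2
        have hxα : x⁻¹ * p.vertex α ∈ H l := by
          have := (H l).mul_mem hs4 ((H l).inv_mem (hc.mem hαs (by omega)))
          simpa [mul_assoc] using this
        have hxC : ∀ r, x⁻¹ * p.vertex r ∈ H l → (p.vertex α)⁻¹ * p.vertex r ∈ H l := by
          intro r hr
          simpa [mul_assoc] using (H l).mul_mem ((H l).inv_mem hxα) hr
        have hα : i - t ≤ α := by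
          by_contra! hlt
          rcases htfar with rfl | hfar
          · rw [show i - (i - i₁) = i₁ by omega] at hlt hs1
            exact hi₁p ⟨l, α, β, hc, hlt, by omega⟩
          · have h6 := hc.mem (t := i - t) hlt.le (by omega)
            have h7 := hnear l x (p.vertex (i - t)) hxD (by
              simpa [mul_assoc] using (H l).mul_mem hxα h6)
            linarith
        have hβ := hc.mem (hc.1.trans (Nat.le_succ β)) le_rfl
        have h6 := Route.of_mem (X := X) (φ := φ) hxα hβ
        have h7 := Route.of_path (p := p) (g := x) (φ := φ) (l := l) hα (by omega)
          fun r hr1 hr2 hr3 hr4 => by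
            have := hpb.mem_component hc hr3 (hxC r hr4)
            omega
        have h8 := Route.of_path (p := p) (g := x) (φ := φ) (l := l) hβi hi
          fun r hr1 hr2 hr3 hr4 => by
            have := hpb.mem_component hc hr3 (hxC r hr4)
            omega
        refine ⟨_, ?_, ((h7.trans h6).trans h8).mono (by omega)⟩
        rw [zero_add, add_zero]
        refine (abs_xDist_sub_le hXgen x _ _).trans ?_
        rw [xDist_comm hXgen]
        by_contra! hlong
        obtain ⟨a', b', hc', hcc⟩ := hisol p q hp hq hpq hpb l α β hc hlong
        refine hnot (Or.inr ⟨l, a', b', hc', ?_⟩)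
        have := (H l).inv_mem ((H l).mul_mem hxα hcc)
        simpa [mul_assoc] using this
      · refine ⟨0, by simpa using hε₂, Route.mono (Route.of_path (by omega) hi
          fun s hs1 hs2 hs3 hs4 => hex ⟨s, hs1, hs2, hs3, hs4⟩) (by omega)⟩
    have hvlen : v.length + w.length ≤ ⌈D⌉₊ := by
      have := hoD
      rw [hvw] at this
      simp only [List.length_append, List.length_cons] at this
      omega
    have h6 := xDist_le_of_route hXgen hroute hxe
      (((((h1.symm_zero.trans h5.symm).trans h4).trans h3.symm_zero).trans h2.symm_zero).mono
        (m := 3 * B + 2 * ⌈D⌉₊ + 2) (by omega))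
    rw [zero_add, add_zero, add_zero, add_zero, abs_neg] at h6
    linarith
  refine ⟨j, hj, hjp, ?_⟩
  have h1 := xDist_mul_wval_le hXgen hletter
  rw [hoz] at h1
  have h2 : (o.length : ℝ) * M ≤ ⌈D⌉₊ * M := by
    gcongr
  have h3 : (xDist X u (q.vertex j) : ℝ) ≤ xDist X u z + xDist X z (q.vertex j) := by
    exact_mod_cast xDist_triangle hXgen _ _ _
  linarith

end PhaseVertices

end RelHyp

/-- Theorem 3.23. Let `G` be generated by a finite set `X` and hyperbolic
relative to `{H₁,…,H_m}`. For any `λ ≥ 1`, `c ≥ 0`, `k ≥ 0` there exists `ε = ε(λ,c,k)` such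
that for any two `k`-similar `(λ,c)`-quasi-geodesics `p, q` without backtracking in
`Γ(G, X ∪ 𝓗)`: (1) the phase vertices of `p` and `q` lie in the closed `ε`-neighborhoods
(w.r.t. `dist_X`) of each other; (2) any `H_i`-component `s` of `p` with `dist_X(s₋,s₊) > ε` is
connected to an `H_i`-component of `q`; (3) connected `H_i`-components `s` of `p` and `t` of `q`
satisfy `dist_X(s₋,t₋) ≤ ε` and `dist_X(s₊,t₊) ≤ ε`. -/
theorem statement_9 {G : Type*} [Group G] {m : ℕ} (H : Fin m → Subgroup G)
    (X : Set G) (hXfin : X.Finite) (hXgen : Subgroup.closure X = ⊤)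
    (hhyp : IsRelHyperbolic H) :
    ∀ lam c k : ℝ, 1 ≤ lam → 0 ≤ c → 0 ≤ k →
      ∃ ε : ℝ,
        ∀ p q : RelPath H X, IsQuasiGeodesic lam c p → IsQuasiGeodesic lam c q →
          Similar k p q → NoBacktracking p → NoBacktracking q →
          ((∀ u ≤ p.len, IsPhase p u →
              ∃ v ≤ q.len, IsPhase q v ∧ (xDist X (p.vertex u) (q.vertex v) : ℝ) ≤ ε) ∧
           (∀ u ≤ q.len, IsPhase q u →
              ∃ v ≤ p.len, IsPhase p v ∧ (xDist X (q.vertex u) (p.vertex v) : ℝ) ≤ ε)) ∧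
          (∀ (i : Fin m) (a b : ℕ), IsComponent p i a b →
            ε < (xDist X (p.vertex a) (p.vertex (b + 1)) : ℝ) →
            ∃ a' b', IsComponent q i a' b' ∧ ConnectedComp p q i a a') ∧
          (∀ (i : Fin m) (a b a' b' : ℕ), IsComponent p i a b → IsComponent q i a' b' →
            ConnectedComp p q i a a' →
            (xDist X (p.vertex a) (q.vertex a') : ℝ) ≤ ε ∧
            (xDist X (p.vertex (b + 1)) (q.vertex (b' + 1)) : ℝ) ≤ ε) := by
  intro lam c k hlam hc hk
  obtain ⟨ε₁, hε₁, h₁⟩ := exists_phase_bound (H := H) hXfin hXgen hhyp hlam hc hk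
  obtain ⟨ε₂, hε₂, h₂⟩ := exists_isolated_bound (H := H) hXfin hXgen hhyp hlam hc hk
  obtain ⟨ε₃, hε₃, h₃⟩ := exists_connected_bound (H := H) hXfin hXgen hhyp hlam hc hk
  refine ⟨ε₁ + ε₂ + ε₃, fun p q hp hq hpq hpb hqb => ⟨⟨fun u hu hup => ?_, fun u hu hup => ?_⟩,
    fun i a b hs hlong => h₂ p q hp hq hpq hpb i a b hs (by linarith),
    fun i a b a' b' hs ht hst => ?_⟩⟩
  · obtain ⟨v, hv, hvp, hd⟩ := h₁ p q hp hq hpq hpb hqb u hu hup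
    exact ⟨v, hv, hvp, by linarith⟩
  · obtain ⟨v, hv, hvp, hd⟩ := h₁ q p hq hp (hpq.symm hXgen) hqb hpb u hu hup
    exact ⟨v, hv, hvp, by linarith⟩
  · obtain ⟨hd, hd'⟩ := h₃ p q hp hq hpq hpb hqb i a b a' b' hs ht hst
    exact ⟨by linarith, by linarith⟩
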